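/- Fix x, v ∈ (0,∞)^d. For each t > 0 let 𝒫_t be a Poisson point process on ℝ^d with constant intensity t, and let (t_n)_{n∈ℕ} be an increasing sequence of positive reals with ∑_{n=1}^∞ exp(−ε t_n^{1/d}) < ∞ for every ε > 0. Then t_n^{-1/d} ℓ(𝒫_{t_n} ∩ S_{x,v}) converges completely to c_d / (d (v_1 ⋯ v_d)^{1/d}). -/

import Mathlib

open MeasureTheory Filter Set Topology

noncomputable section

/-- `ℓ(A)`: the maximal cardinality of a chain (finite subset totally ordered by the
coordinatewise partial order `≤`) contained in `A ⊆ ℝ^d`. -/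
def chainLength (d : ℕ) (A : Set (Fin d → ℝ)) : ℕ :=
  sSup {n : ℕ | ∃ C : Finset (Fin d → ℝ),
    ↑C ⊆ A ∧ IsChain (· ≤ ·) (C : Set (Fin d → ℝ)) ∧ C.card = n}

/-- The class `ℬ` of nonnegative, locally bounded, Lebesgue-measurable functions. -/
def MemB (d : ℕ) (f : (Fin d → ℝ) → ℝ) : Prop :=
  Measurable f ∧ (∀ x, 0 ≤ f x) ∧ ∀ x : Fin d → ℝ, ∃ U ∈ 𝓝 x, BddAbove (f '' U)

/-- The Euclidean norm on `ℝ^d` (modelled as `Fin d → ℝ`). -/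
def euclNorm (d : ℕ) (x : Fin d → ℝ) : ℝ := Real.sqrt (∑ i, (x i) ^ 2)

/-- The expectation `E[ℓ_n]` of the length of a longest chain among `n` i.i.d. points
uniformly distributed in the unit cube `[0,1]^d`. -/
def BWexpect (d n : ℕ) : ℝ :=
  ∫ X : Fin n → Fin d → ℝ, (chainLength d (Set.range X) : ℝ)
    ∂(Measure.pi fun _ => volume.restrict (Set.Icc (0 : Fin d → ℝ) 1))

/-- `c` is the Bollobás–Winkler constant `c_d`: `c > 0` and `n^{-1/d} E[ℓ_n] → c`. -/
def IsBWConstant (d : ℕ) (c : ℝ) : Prop :=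
  0 < c ∧ Tendsto (fun n : ℕ => (n : ℝ) ^ (-(1 : ℝ) / d) * BWexpect d n) atTop (nhds c)

/-- A Poisson point process on `ℝ^d` with intensity function `g`, on a probability space
`(Ω, P)`: a random at-most-countable subset of `ℝ^d` such that for every bounded Borel set `A`
the count `#(pts ω ∩ A)` is measurable with Poisson distribution of mean `∫_A g`, and counts of
pairwise disjoint Borel sets are independent. -/
structure PoissonPP (d : ℕ) {Ω : Type*} [MeasurableSpace Ω] (P : Measure Ω)
    (g : (Fin d → ℝ) → ℝ) where
  pts : Ω → Set (Fin d → ℝ)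
  countable : ∀ ω, (pts ω).Countable
  measur : ∀ A : Set (Fin d → ℝ), MeasurableSet A → Bornology.IsBounded A →
    ∀ k : ℕ, MeasurableSet {ω | (pts ω ∩ A).encard = k}
  poisson : ∀ A : Set (Fin d → ℝ), MeasurableSet A → Bornology.IsBounded A →
    ∀ k : ℕ, P {ω | (pts ω ∩ A).encard = k}
      = ENNReal.ofReal (Real.exp (-(∫ x in A, g x)) * (∫ x in A, g x) ^ k / k.factorial)
  indep : ∀ (n : ℕ) (A : Fin n → Set (Fin d → ℝ)),
    (∀ i, MeasurableSet (A i)) → (∀ i, Bornology.IsBounded (A i)) →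
    (Pairwise fun i j => Disjoint (A i) (A j)) →
    ∀ k : Fin n → ℕ,
      P (⋂ i, {ω | (pts ω ∩ A i).encard = k i})
        = ∏ i, P {ω | (pts ω ∩ A i).encard = k i}

/-- Upper semicontinuous envelope `f*`. -/
def upperEnv (d : ℕ) (f : (Fin d → ℝ) → ℝ) (x : Fin d → ℝ) : ℝ := limsup f (𝓝 x)

/-- Lower semicontinuous envelope `f_*`. -/
def lowerEnv (d : ℕ) (f : (Fin d → ℝ) → ℝ) (x : Fin d → ℝ) : ℝ := liminf f (𝓝 x)

/-- The simplex `S_{x,v} = {z : z ≤ x, ⟨x-z,v⟩ ≤ 1}`. -/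
def simplexS (d : ℕ) (x v : Fin d → ℝ) : Set (Fin d → ℝ) :=
  {z | z ≤ x ∧ ∑ i, (x i - z i) * v i ≤ 1}

/-- `u` is a nondecreasing viscosity solution of the problem (P):
`u_{x_1} ⋯ u_{x_d} = (c_d/d)^d f` in `(0,∞)^d`, `u = 0` on `∂ℝ^d_+`. -/
def IsNDViscSol (d : ℕ) (c : ℝ) (f u : (Fin d → ℝ) → ℝ) : Prop :=
  ContinuousOn u (Set.Ici 0) ∧
  (∀ x y : Fin d → ℝ, 0 ≤ x → x ≤ y → u x ≤ u y) ∧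
  (∀ x : Fin d → ℝ, 0 ≤ x → (∃ i, x i = 0) → u x = 0) ∧
  (∀ x₀ : Fin d → ℝ, (∀ i, 0 < x₀ i) →
    ∀ φ : (Fin d → ℝ) → ℝ, ContDiff ℝ ((⊤ : ℕ∞) : WithTop ℕ∞) φ →
      IsLocalMaxOn (fun y => u y - φ y) (Set.Ici 0) x₀ →
      ∏ i, fderiv ℝ φ x₀ (Pi.single i 1) ≤ (c / d) ^ d * upperEnv d f x₀) ∧
  (∀ x₀ : Fin d → ℝ, (∀ i, 0 < x₀ i) →
    ∀ φ : (Fin d → ℝ) → ℝ, ContDiff ℝ ((⊤ : ℕ∞) : WithTop ℕ∞) φ →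
      IsLocalMinOn (fun y => u y - φ y) (Set.Ici 0) x₀ →
      (c / d) ^ d * lowerEnv d f x₀ ≤ ∏ i, fderiv ℝ φ x₀ (Pi.single i 1))

/-- Expectation of `f` over the random subset of `T` containing each element independently with
probability `p`. -/
def bernExp {α : Type*} (p : ℝ) (T : Finset α) (f : Finset α → ℝ) : ℝ :=
  ∑ S ∈ T.powerset, p ^ S.card * (1 - p) ^ (T.card - S.card) * f S

section Bernoulli

variable {α : Type*} {p : ℝ} {T : Finset α} {f g : Finset α → ℝ}

lemma bernExp_add : bernExp p T (fun S => f S + g S) = bernExp p T f + bernExp p T g := by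
  simp [bernExp, mul_add, Finset.sum_add_distrib]

lemma bernExp_const_mul (a : ℝ) : bernExp p T (fun S => a * f S) = a * bernExp p T f := by
  simp only [bernExp, Finset.mul_sum]
  exact Finset.sum_congr rfl fun _ _ => by ring

lemma bernExp_sum {ι : Type*} (s : Finset ι) (F : ι → Finset α → ℝ) :
    bernExp p T (fun S => ∑ i ∈ s, F i S) = ∑ i ∈ s, bernExp p T (F i) := by
  simp only [bernExp, Finset.mul_sum]
  exact Finset.sum_comm

lemma bernExp_one : bernExp p T (fun _ => 1) = 1 := by
  simp [bernExp, Finset.sum_pow_mul_eq_add_pow]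

lemma bernExp_congr (h : ∀ S ⊆ T, f S = g S) : bernExp p T f = bernExp p T g :=
  Finset.sum_congr rfl fun S hS => by rw [h S (Finset.mem_powerset.1 hS)]

lemma bernExp_mono (hp0 : 0 ≤ p) (hp1 : p ≤ 1) (h : ∀ S ⊆ T, f S ≤ g S) :
    bernExp p T f ≤ bernExp p T g := by
  refine Finset.sum_le_sum fun S hS => ?_
  have : 0 ≤ 1 - p := by linarith
  exact mul_le_mul_of_nonneg_left (h S (Finset.mem_powerset.1 hS)) (by positivity)

lemma bernExp_pos (hp0 : 0 ≤ p) (hp1 : p ≤ 1) (h : ∀ S, 0 < f S) : 0 < bernExp p T f := by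
  obtain ⟨S₀, -, hS₀⟩ := T.powerset.exists_min_image f ⟨∅, by simp⟩
  have := bernExp_mono (f := fun _ => f S₀ * 1) hp0 hp1
    (fun S hS => (mul_one (f S₀)).le.trans (hS₀ S (Finset.mem_powerset.2 hS)))
  rw [bernExp_const_mul, bernExp_one, mul_one] at this
  exact (h S₀).trans_le this

lemma bernExp_insert [DecidableEq α] {a : α} (ha : a ∉ T) :
    bernExp p (insert a T) f
      = (1 - p) * bernExp p T f + p * bernExp p T (fun S => f (insert a S)) := by
  simp only [bernExp, Finset.sum_powerset_insert ha, Finset.mul_sum]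
  congr 1
  · refine Finset.sum_congr rfl fun S hS => ?_
    have := Finset.card_le_card (Finset.mem_powerset.1 hS)
    rw [Finset.card_insert_of_notMem ha, Nat.sub_add_comm this]
    ring
  · refine Finset.sum_congr rfl fun S hS => ?_
    have hS' := Finset.mem_powerset.1 hS
    rw [Finset.card_insert_of_notMem ha, Finset.card_insert_of_notMem fun h => ha (hS' h),
      Nat.add_sub_add_right]
    ring

/-- Joint convexity of the relative entropy integrand. -/
lemma relEntropy_bernExp_le (hp0 : 0 ≤ p) (hp1 : p ≤ 1) (hf : ∀ S, 0 < f S) (hg : ∀ S, 0 < g S) :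
    bernExp p T f * Real.log (bernExp p T f / bernExp p T g) - bernExp p T f + bernExp p T g
      ≤ bernExp p T (fun S => f S * Real.log (f S / g S) - f S + g S) := by
  set A := bernExp p T f with hA
  set B := bernExp p T g with hB
  have hA0 : 0 < A := bernExp_pos hp0 hp1 hf
  have hB0 : 0 < B := bernExp_pos hp0 hp1 hg
  have key : ∀ S, Real.log (A / B) * f S + (1 - A / B) * g S
      ≤ f S * Real.log (f S / g S) - f S + g S := by
    intro S
    have h1 := Real.log_le_sub_one_of_pos (x := (A / B) / (f S / g S))
      (by have := hf S; have := hg S; positivity)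
    rw [Real.log_div (by positivity) (div_pos (hf S) (hg S)).ne'] at h1
    have h2 := mul_le_mul_of_nonneg_left h1 (hf S).le
    have h3 : f S * ((A / B) / (f S / g S) - 1) = A / B * g S - f S := by
      have := (hf S).ne'; have := (hg S).ne'; field_simp
    rw [h3] at h2
    linarith
  have h := bernExp_mono (T := T) hp0 hp1 fun S _ => key S
  rw [bernExp_add, bernExp_const_mul, bernExp_const_mul, ← hA, ← hB] at h
  have : (1 - A / B) * B = B - A := by field_simp
  rw [this] at h
  linarith

/-- Subadditivity of entropy, compared coordinatewise with the value at the erased set. -/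
lemma entropy_bernExp_le [DecidableEq α] (hp0 : 0 ≤ p) (hp1 : p ≤ 1) (T : Finset α)
    (f : Finset α → ℝ) (hf : ∀ S, 0 < f S) :
    bernExp p T (fun S => f S * Real.log (f S)) - bernExp p T f * Real.log (bernExp p T f)
      ≤ ∑ i ∈ T, bernExp p T
        (fun S => f S * Real.log (f S / f (S.erase i)) - f S + f (S.erase i)) := by
  induction T using Finset.induction_on generalizing f with
  | empty => simp [bernExp]
  | insert a T ha ih =>
    have ih0 := ih f hf
    have ih1 := ih (fun S => f (insert a S)) fun S => hf _
    rw [Finset.sum_insert ha]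
    simp only [bernExp_insert ha]
    have e0 : bernExp p T (fun S => f S * Real.log (f S / f (S.erase a)) - f S + f (S.erase a))
        = 0 := by
      rw [bernExp_congr (g := fun _ => 0)]
      · simp [bernExp]
      · intro S hS
        rw [Finset.erase_eq_of_notMem fun h => ha (hS h), div_self (hf S).ne']
        simp
    have e1 : bernExp p T (fun S => f (insert a S) *
        Real.log (f (insert a S) / f ((insert a S).erase a)) - f (insert a S)
          + f ((insert a S).erase a))
        = bernExp p T (fun S => f (insert a S) *
        Real.log (f (insert a S) / f S) - f (insert a S) + f S) := by
      refine bernExp_congr fun S hS => ?_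
      rw [Finset.erase_insert fun h => ha (hS h)]
    have e2 : ∑ i ∈ T, bernExp p T (fun S => f (insert a S) *
        Real.log (f (insert a S) / f ((insert a S).erase i)) - f (insert a S)
          + f ((insert a S).erase i))
        = ∑ i ∈ T, bernExp p T (fun S => f (insert a S) *
        Real.log (f (insert a S) / f (insert a (S.erase i))) - f (insert a S)
          + f (insert a (S.erase i))) := by
      refine Finset.sum_congr rfl fun i hi => bernExp_congr fun S hS => ?_
      rw [Finset.erase_insert_of_ne (ne_of_mem_of_not_mem hi ha).symm]
    rw [Finset.sum_add_distrib, ← Finset.mul_sum, ← Finset.mul_sum, e0, e1, e2]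
    have h3 := relEntropy_bernExp_le (T := T) hp0 hp1 (fun S => hf (insert a S)) hf
    have hA0 : 0 < bernExp p T f := bernExp_pos hp0 hp1 hf
    have hA1 : 0 < bernExp p T fun S => f (insert a S) := bernExp_pos hp0 hp1 fun S => hf _
    set A₀ := bernExp p T f
    set A₁ := bernExp p T fun S => f (insert a S)
    have hA : 0 < (1 - p) * A₀ + p * A₁ := by
      rcases hp0.eq_or_lt with rfl | h
      · simpa using hA0
      · have : 0 ≤ 1 - p := by linarith
        positivity
    have h4 := Real.log_le_sub_one_of_pos (div_pos hA0 hA)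
    rw [Real.log_div hA0.ne' hA.ne'] at h4
    have h5 := mul_le_mul_of_nonneg_left h4 hA.le
    have h6 : ((1 - p) * A₀ + p * A₁) * (A₀ / ((1 - p) * A₀ + p * A₁) - 1)
        = A₀ - ((1 - p) * A₀ + p * A₁) := by
      field_simp
    rw [h6] at h5
    rw [Real.log_div hA1.ne' hA0.ne'] at h3
    have h7 := mul_le_mul_of_nonneg_left h3 hp0
    have h8 := mul_le_mul_of_nonneg_left ih0 (sub_nonneg.2 hp1)
    have h9 := mul_le_mul_of_nonneg_left ih1 hp0
    nlinarith

end Bernoulli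

/-- Self-bounding set functions with increments in `{0, 1}`. -/
structure IsConfigFun {α : Type*} [DecidableEq α] (Z : Finset α → ℕ) : Prop where
  erase_le : ∀ S i, Z (S.erase i) ≤ Z S
  le_erase_add_one : ∀ S i, Z S ≤ Z (S.erase i) + 1
  card_filter_le : ∀ S : Finset α, (S.filter fun i => Z (S.erase i) < Z S).card ≤ Z S

lemma hasDerivAt_bernExp_pow {α : Type*} {Z : Finset α → ℕ} {p : ℝ} (T : Finset α) (s : ℝ) :
    HasDerivAt (fun s => bernExp p T (fun S => s ^ Z S))
      (bernExp p T (fun S => Z S * s ^ (Z S - 1))) s := by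
  unfold bernExp
  exact HasDerivAt.fun_sum fun S _ => (hasDerivAt_pow (Z S) s).const_mul _

section ConfigFun

variable {α : Type*} [DecidableEq α] {Z : Finset α → ℕ} {p : ℝ}

lemma IsConfigFun.sum_relEntropy_le (hZ : IsConfigFun Z) {s : ℝ} (hs : 0 < s) (S T : Finset α) :
    ∑ i ∈ T, (s ^ Z S * Real.log (s ^ Z S / s ^ Z (S.erase i)) - s ^ Z S + s ^ Z (S.erase i))
      ≤ (Real.log s - 1 + s⁻¹) * (Z S * s ^ Z S) := by
  have h0 : 0 ≤ Real.log s - 1 + s⁻¹ := by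
    have := Real.one_sub_inv_le_log_of_pos hs
    linarith
  have hterm : ∀ i, s ^ Z S * Real.log (s ^ Z S / s ^ Z (S.erase i)) - s ^ Z S
      + s ^ Z (S.erase i)
      = if Z (S.erase i) < Z S then (Real.log s - 1 + s⁻¹) * s ^ Z S else 0 := by
    intro i
    split_ifs with h
    · have h1 : Z S = Z (S.erase i) + 1 := le_antisymm (hZ.le_erase_add_one S i) h
      rw [h1, pow_succ]
      have : s ^ Z (S.erase i) * s / s ^ Z (S.erase i) = s := by field_simp
      rw [this]
      field_simp
    · have h1 : Z S = Z (S.erase i) := le_antisymm (not_lt.1 h) (hZ.erase_le S i)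
      rw [← h1, div_self (by positivity)]
      simp
  simp only [hterm]
  rw [← Finset.sum_filter, Finset.sum_const, nsmul_eq_mul]
  have hsub : (T.filter fun i => Z (S.erase i) < Z S) ⊆ S.filter fun i => Z (S.erase i) < Z S := by
    intro i hi
    rw [Finset.mem_filter] at hi ⊢
    refine ⟨by_contra fun h => ?_, hi.2⟩
    rw [Finset.erase_eq_of_notMem h] at hi
    exact lt_irrefl _ hi.2
  have hc : ((T.filter fun i => Z (S.erase i) < Z S).card : ℝ) ≤ Z S := by
    exact_mod_cast (Finset.card_le_card hsub).trans (hZ.card_filter_le S)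
  calc _ ≤ (Z S : ℝ) * ((Real.log s - 1 + s⁻¹) * s ^ Z S) := by gcongr
    _ = _ := by ring

lemma IsConfigFun.entropy_ineq (hZ : IsConfigFun Z) (hp0 : 0 ≤ p) (hp1 : p ≤ 1) (T : Finset α)
    {s : ℝ} (hs : 0 < s) :
    (1 - s⁻¹) * bernExp p T (fun S => Z S * s ^ Z S)
      ≤ bernExp p T (fun S => s ^ Z S) * Real.log (bernExp p T (fun S => s ^ Z S)) := by
  have h1 := entropy_bernExp_le hp0 hp1 T (fun S => s ^ Z S) fun S => by positivity
  rw [← bernExp_sum] at h1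
  have h2 := bernExp_mono (T := T) hp0 hp1 fun S _ => hZ.sum_relEntropy_le hs S T
  rw [bernExp_const_mul] at h2
  have h3 : bernExp p T (fun S => s ^ Z S * Real.log (s ^ Z S))
      = Real.log s * bernExp p T (fun S => Z S * s ^ Z S) := by
    rw [← bernExp_const_mul]
    refine bernExp_congr fun S _ => ?_
    rw [Real.log_pow]
    ring
  rw [h3] at h1
  linarith

/-- A function with `L 1 = 0` and `(s - 1) L' ≤ L` lies below its tangent at `1`. -/
lemma le_tangent_of_sub_one_mul_deriv_le {L L' : ℝ → ℝ}
    (hL : ∀ s, 0 < s → HasDerivAt L (L' s) s) (h1 : L 1 = 0)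
    (hle : ∀ s, 0 < s → (s - 1) * L' s ≤ L s) {s : ℝ} (hs : 0 < s) :
    L s ≤ (s - 1) * L' 1 := by
  have hG : ∀ s, 0 < s → s ≠ 1 → HasDerivAt (fun s => L s / (s - 1))
      ((L' s * (s - 1) - L s * 1) / (s - 1) ^ 2) s := fun s hs hs1 =>
    (hL s hs).div ((hasDerivAt_id s).sub_const 1) (sub_ne_zero.2 hs1)
  have hG0 : ∀ s, 0 < s → (L' s * (s - 1) - L s * 1) / (s - 1) ^ 2 ≤ 0 := fun s hs =>
    div_nonpos_of_nonpos_of_nonneg (by linarith [hle s hs]) (sq_nonneg _)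
  have hlim : Tendsto (fun s => L s / (s - 1)) (𝓝[≠] 1) (𝓝 (L' 1)) := by
    have := hasDerivAt_iff_tendsto_slope.1 (hL 1 one_pos)
    refine this.congr fun s => ?_
    rw [slope_def_field, h1, sub_zero]
  rcases lt_trichotomy s 1 with h | rfl | h
  · have hanti : AntitoneOn (fun s => L s / (s - 1)) (Ioo 0 1) := by
      refine antitoneOn_of_deriv_nonpos (convex_Ioo 0 1) ?_ ?_ ?_
      · exact fun r hr => (hG r hr.1 hr.2.ne).continuousAt.continuousWithinAt
      · rw [interior_Ioo]
        exact fun r hr => (hG r hr.1 hr.2.ne).differentiableAt.differentiableWithinAt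
      · rw [interior_Ioo]
        intro r hr
        rw [(hG r hr.1 hr.2.ne).deriv]
        exact hG0 r hr.1
    have hle' : L' 1 ≤ L s / (s - 1) := by
      refine le_of_tendsto (hlim.mono_left (nhdsLT_le_nhdsNE 1)) ?_
      filter_upwards [Ioo_mem_nhdsLT h] with r hr
      exact hanti ⟨hs, h⟩ ⟨hs.trans hr.1, hr.2⟩ hr.1.le
    rw [le_div_iff_of_neg (by linarith)] at hle'
    linarith
  · simp [h1]
  · have hanti : AntitoneOn (fun s => L s / (s - 1)) (Ioi 1) := by
      have hpos : ∀ r ∈ Ioi (1 : ℝ), 0 < r := fun r hr => one_pos.trans hr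
      refine antitoneOn_of_deriv_nonpos (convex_Ioi 1) ?_ ?_ ?_
      · exact fun r hr => (hG r (hpos r hr) (ne_of_gt hr)).continuousAt.continuousWithinAt
      · rw [interior_Ioi]
        exact fun r hr => (hG r (hpos r hr) (ne_of_gt hr)).differentiableAt.differentiableWithinAt
      · rw [interior_Ioi]
        intro r hr
        rw [(hG r (hpos r hr) (ne_of_gt hr)).deriv]
        exact hG0 r (hpos r hr)
    have hle' : L s / (s - 1) ≤ L' 1 := by
      refine ge_of_tendsto (hlim.mono_left (nhdsGT_le_nhdsNE 1)) ?_
      filter_upwards [Ioo_mem_nhdsGT h] with r hr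
      exact hanti hr.1 h hr.2.le
    rw [div_le_iff₀ (by linarith)] at hle'
    linarith

/-- Configuration functions are sub-Poissonian. -/
theorem IsConfigFun.bernExp_pow_le (hZ : IsConfigFun Z) (hp0 : 0 ≤ p) (hp1 : p ≤ 1)
    (T : Finset α) {s : ℝ} (hs : 0 < s) :
    bernExp p T (fun S => s ^ Z S) ≤ Real.exp ((s - 1) * bernExp p T (fun S => Z S)) := by
  have hpos : ∀ s : ℝ, 0 < s → 0 < bernExp p T (fun S => s ^ Z S) := fun s hs =>
    bernExp_pos hp0 hp1 fun S => by positivity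
  have key := le_tangent_of_sub_one_mul_deriv_le
    (L := fun s => Real.log (bernExp p T (fun S => s ^ Z S)))
    (L' := fun s => bernExp p T (fun S => Z S * s ^ (Z S - 1)) / bernExp p T (fun S => s ^ Z S))
    (fun s hs => (hasDerivAt_bernExp_pow T s).log (hpos s hs).ne')
    (by simp [bernExp_one]) ?_ hs
  · simp only [one_pow, mul_one, bernExp_one, div_one] at key
    rw [← Real.exp_log (hpos s hs)]
    exact Real.exp_le_exp.2 key
  · intro s hs
    have h := hZ.entropy_ineq hp0 hp1 T hs
    have h2 : bernExp p T (fun S => Z S * s ^ Z S)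
        = s * bernExp p T (fun S => Z S * s ^ (Z S - 1)) := by
      rw [← bernExp_const_mul]
      refine bernExp_congr fun S _ => ?_
      rcases Nat.eq_zero_or_pos (Z S) with h0 | h0
      · simp [h0]
      · obtain ⟨k, hk⟩ := Nat.exists_eq_succ_of_ne_zero h0.ne'
        rw [hk, Nat.succ_sub_one, pow_succ]
        ring
    rw [h2] at h
    have h3 : (1 - s⁻¹) * (s * bernExp p T (fun S => Z S * s ^ (Z S - 1)))
        = (s - 1) * bernExp p T (fun S => Z S * s ^ (Z S - 1)) := by
      field_simp
    rw [h3] at h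
    rw [← mul_div_assoc, div_le_iff₀ (hpos s hs)]
    linarith

end ConfigFun

/-- The largest size of a subset of `S` which is a chain for the relation `r`. -/
def relChainLength {α : Type*} (r : α → α → Prop) (S : Finset α) : ℕ :=
  open Classical in (S.powerset.filter fun C : Finset α => IsChain r (C : Set α)).sup Finset.card

section RelChainLength

variable {α : Type*} {r : α → α → Prop} {S S' C : Finset α}

lemma card_le_relChainLength (hC : C ⊆ S) (h : IsChain r (C : Set α)) :
    C.card ≤ relChainLength r S := by
  classical
  unfold relChainLength
  exact Finset.le_sup (f := Finset.card) (Finset.mem_filter.2 ⟨Finset.mem_powerset.2 hC, h⟩)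

lemma exists_card_eq_relChainLength (r : α → α → Prop) (S : Finset α) :
    ∃ C ⊆ S, IsChain r (C : Set α) ∧ C.card = relChainLength r S := by
  classical
  obtain ⟨C, hC, h⟩ := Finset.exists_mem_eq_sup
    (S.powerset.filter fun C : Finset α => IsChain r (C : Set α)) ⟨∅, by simp⟩ Finset.card
  rw [Finset.mem_filter, Finset.mem_powerset] at hC
  exact ⟨C, hC.1, hC.2, by unfold relChainLength; convert h.symm⟩

lemma relChainLength_mono (h : S ⊆ S') : relChainLength r S ≤ relChainLength r S' := by
  obtain ⟨C, hC, hc, h'⟩ := exists_card_eq_relChainLength r S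
  rw [← h']
  exact card_le_relChainLength (hC.trans h) hc

lemma relChainLength_le_card : relChainLength r S ≤ S.card := by
  obtain ⟨C, hC, -, h'⟩ := exists_card_eq_relChainLength r S
  rw [← h']
  exact Finset.card_le_card hC

lemma isConfigFun_relChainLength [DecidableEq α] (r : α → α → Prop) :
    IsConfigFun (relChainLength r) where
  erase_le S i := relChainLength_mono (S.erase_subset i)
  le_erase_add_one S i := by
    obtain ⟨C, hC, hc, h'⟩ := exists_card_eq_relChainLength r S
    have h1 : (C.erase i).card ≤ relChainLength r (S.erase i) :=
      card_le_relChainLength (Finset.erase_subset_erase i hC) (hc.mono (by simp))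
    have h2 := Finset.pred_card_le_card_erase (s := C) (a := i)
    omega
  card_filter_le S := by
    obtain ⟨C, hC, hc, h'⟩ := exists_card_eq_relChainLength r S
    rw [← h']
    refine Finset.card_le_card fun i hi => by_contra fun hiC => ?_
    have h1 := card_le_relChainLength (S := S.erase i)
      (fun j hj => Finset.mem_erase.2 ⟨ne_of_mem_of_not_mem hj hiC, hC hj⟩) hc
    have h2 := (Finset.mem_filter.1 hi).2
    omega

end RelChainLength

section RandomSet

variable {α : Type*}

lemma eq_of_sum_powerset_eq {Q R : Finset α → ℝ}
    (h : ∀ T : Finset α, ∑ S ∈ T.powerset, Q S = ∑ S ∈ T.powerset, R S) : Q = R := by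
  classical
  ext T
  induction T using Finset.strongInduction with
  | H T ih =>
    have hT := h T
    rw [← Finset.sum_erase_add _ _ (Finset.mem_powerset_self T),
      ← Finset.sum_erase_add _ _ (Finset.mem_powerset_self T)] at hT
    have : ∑ S ∈ T.powerset.erase T, Q S = ∑ S ∈ T.powerset.erase T, R S := by
      refine Finset.sum_congr rfl fun S hS => ih S ?_
      rw [Finset.mem_erase, Finset.mem_powerset] at hS
      exact hS.2.ssubset_of_ne hS.1
    linarith

lemma sum_powerset_bernoulli [Fintype α] (p : ℝ) (T : Finset α) :
    ∑ S ∈ T.powerset, p ^ S.card * (1 - p) ^ (Fintype.card α - S.card)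
      = (1 - p) ^ (Fintype.card α - T.card) := by
  have h := Finset.sum_pow_mul_eq_add_pow p (1 - p) T
  rw [add_sub_cancel, one_pow] at h
  calc _ = ∑ S ∈ T.powerset, (1 - p) ^ (Fintype.card α - T.card)
        * (p ^ S.card * (1 - p) ^ (T.card - S.card)) := by
        refine Finset.sum_congr rfl fun S hS => ?_
        have h1 := Finset.card_le_card (Finset.mem_powerset.1 hS)
        have h2 := Finset.card_le_univ T
        rw [mul_left_comm, ← pow_add]
        congr 2
        omega
    _ = _ := by rw [← Finset.mul_sum, h, mul_one]

lemma bernExp_univ_eq [Fintype α] {p : ℝ} {Q : Finset α → ℝ}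
    (hQ : ∀ T : Finset α, ∑ S ∈ T.powerset, Q S = (1 - p) ^ (Fintype.card α - T.card))
    (f : Finset α → ℝ) : bernExp p Finset.univ f = ∑ S, Q S * f S := by
  have : Q = fun S => p ^ S.card * (1 - p) ^ (Fintype.card α - S.card) :=
    eq_of_sum_powerset_eq fun T => by rw [hQ, sum_powerset_bernoulli]
  rw [this, bernExp, Finset.powerset_univ, Finset.card_univ]

variable {Ω : Type*} [MeasurableSpace Ω] {μ : Measure Ω} [IsFiniteMeasure μ] {O : Ω → Finset α}

lemma measureReal_mem_finset (hO : ∀ S, MeasurableSet {ω | O ω = S})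
    (F : Finset (Finset α)) : μ.real {ω | O ω ∈ F} = ∑ S ∈ F, μ.real {ω | O ω = S} := by
  rw [← measureReal_biUnion_finset]
  · congr 1
    ext ω
    simp
  · intro S _ S' _ hne
    exact Set.disjoint_left.2 fun ω (h : O ω = S) (h' : O ω = S') => hne (h.symm.trans h')
  · exact fun S _ => hO S

lemma measurableSet_eq_of_forall_mem [Finite α] (hO : ∀ i, MeasurableSet {ω | i ∈ O ω})
    (S : Finset α) : MeasurableSet {ω | O ω = S} := by
  have : {ω | O ω = S} = ⋂ i, {ω | i ∈ O ω ↔ i ∈ S} := by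
    ext ω
    simp [Finset.ext_iff]
  rw [this]
  refine MeasurableSet.iInter fun i => ?_
  by_cases h : i ∈ S
  · simpa [h] using hO i
  · simp only [h, iff_false]
    exact (hO i).compl

lemma integral_comp_eq_sum [Fintype α] (hO : ∀ S, MeasurableSet {ω | O ω = S})
    (f : Finset α → ℝ) :
    ∫ ω, f (O ω) ∂μ = ∑ S, μ.real {ω | O ω = S} * f S := by
  classical
  have : ∀ ω, f (O ω) = ∑ S, {ω | O ω = S}.indicator (fun _ => f S) ω := by
    intro ω
    simp [Set.indicator_apply]
  simp only [this]
  rw [integral_finsetSum]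
  · refine Finset.sum_congr rfl fun S _ => ?_
    rw [integral_indicator (hO S), setIntegral_const, smul_eq_mul]
  · exact fun S _ => (integrable_const _).indicator (hO S)

/-- Chernoff bound for the longest chain in a Bernoulli random set. -/
lemma measure_relChainLength_le [Fintype α] [DecidableEq α]
    (hO : ∀ S, MeasurableSet {ω | O ω = S}) {p : ℝ} (hp0 : 0 ≤ p) (hp1 : p ≤ 1)
    (hsub : ∀ T, μ.real {ω | O ω ⊆ T} = (1 - p) ^ (Fintype.card α - T.card))
    (r : α → α → Prop) {s : ℝ} (hs : 0 < s) (a : ℝ) (F : Finset (Finset α))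
    (hF : ∀ S ∈ F, a * Real.log s ≤ relChainLength r S * Real.log s) :
    μ {ω | O ω ∈ F} ≤ ENNReal.ofReal (Real.exp
      ((s - 1) * bernExp p Finset.univ (fun S => relChainLength r S) - a * Real.log s)) := by
  have hQ : ∀ T : Finset α, ∑ S ∈ T.powerset, μ.real {ω | O ω = S}
      = (1 - p) ^ (Fintype.card α - T.card) := fun T => by
    rw [← measureReal_mem_finset hO, ← hsub]
    simp
  rw [← ofReal_measureReal]
  refine ENNReal.ofReal_le_ofReal ?_
  have h1 := (isConfigFun_relChainLength r).bernExp_pow_le hp0 hp1 Finset.univ hs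
  rw [bernExp_univ_eq hQ] at h1
  rw [measureReal_mem_finset hO, Real.exp_sub, le_div_iff₀ (Real.exp_pos _)]
  refine le_trans ?_ h1
  rw [Finset.sum_mul]
  refine (Finset.sum_le_sum fun S hS => ?_).trans (Finset.sum_le_univ_sum_of_nonneg fun S =>
    mul_nonneg measureReal_nonneg (pow_nonneg hs.le _))
  gcongr
  rw [← Real.exp_log (pow_pos hs (relChainLength r S)), Real.log_pow]
  exact Real.exp_le_exp.2 (hF S hS)

end RandomSet

section Grid

variable {d N : ℕ}

/-- The slab with index `k` in direction `a` of the grid with mesh `h` hanging below `x`. -/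
def gridSlab (x h : Fin d → ℝ) (a : Fin d) (k : Fin N) : Set (Fin d → ℝ) :=
  {z | z a ∈ Ioc (x a - (k + 1) * h a) (x a - k * h a)}

/-- The cells of the grid with mesh `h` hanging below `x`. -/
def gridCell (x h : Fin d → ℝ) (i : Fin d → Fin N) : Set (Fin d → ℝ) :=
  Set.pi univ fun a => Ioc (x a - (i a + 1) * h a) (x a - i a * h a)

/-- The half-open box with top corner `x` and side lengths `s`. -/
def boxBelow (x s : Fin d → ℝ) : Set (Fin d → ℝ) :=
  Set.pi univ fun a => Ioc (x a - s a) (x a)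

/-- The cells which meet `A`. -/
def occupied (N : ℕ) (x h : Fin d → ℝ) (A : Set (Fin d → ℝ)) : Finset (Fin d → Fin N) :=
  open Classical in Finset.univ.filter fun i => (A ∩ gridCell x h i).Nonempty

/-- Strict order of grid cells in every coordinate. -/
def cellLT (i j : Fin d → Fin N) : Prop := ∀ a, i a < j a

variable {x h : Fin d → ℝ} {A : Set (Fin d → ℝ)}

lemma mem_occupied {i : Fin d → Fin N} :
    i ∈ occupied N x h A ↔ (A ∩ gridCell x h i).Nonempty := by
  simp [occupied]

lemma lt_of_mem_Ioc_grid {u η z w : ℝ} {k l : Fin N}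
    (hη : 0 < η) (hz : z ∈ Ioc (u - (k + 1) * η) (u - k * η))
    (hw : w ∈ Ioc (u - (l + 1) * η) (u - l * η)) (hzw : z ≤ w) : l ≤ k := by
  have h1 : (l : ℝ) * η < (k + 1) * η := by linarith [hz.1, hw.2]
  have h2 : (l : ℝ) < k + 1 := lt_of_mul_lt_mul_right h1 hη.le
  have h3 : (l : ℕ) < k + 1 := by exact_mod_cast h2
  exact Fin.le_def.2 (by omega)

lemma eq_of_mem_gridCell (hh : ∀ a, 0 < h a) {i j : Fin d → Fin N} {z : Fin d → ℝ}
    (hi : z ∈ gridCell x h i) (hj : z ∈ gridCell x h j) : i = j := by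
  ext a
  have h1 := lt_of_mem_Ioc_grid (hh a) (hi a (mem_univ a)) (hj a (mem_univ a)) le_rfl
  have h2 := lt_of_mem_Ioc_grid (hh a) (hj a (mem_univ a)) (hi a (mem_univ a)) le_rfl
  exact congrArg Fin.val (le_antisymm h2 h1)

lemma exists_mem_gridCell (hh : ∀ a, 0 < h a) {z : Fin d → ℝ}
    (hz : z ∈ boxBelow x (fun a => N * h a)) : ∃ i : Fin d → Fin N, z ∈ gridCell x h i := by
  have key : ∀ a, ∃ k : Fin N, z a ∈ Ioc (x a - (k + 1) * h a) (x a - k * h a) := by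
    intro a
    have hza := hz a (mem_univ a)
    have h0 : 0 ≤ (x a - z a) / h a := div_nonneg (by linarith [hza.2]) (hh a).le
    have h1 := Nat.floor_le h0
    have h2 := Nat.lt_floor_add_one ((x a - z a) / h a)
    have h3 : (x a - z a) / h a < N := by
      rw [div_lt_iff₀ (hh a)]
      linarith [hza.1]
    rw [le_div_iff₀ (hh a)] at h1
    rw [div_lt_iff₀ (hh a)] at h2
    exact ⟨⟨_, (Nat.floor_lt h0).2 h3⟩, by simp only [mem_Ioc]; constructor <;> linarith⟩
  choose i hi using key
  exact ⟨i, fun a _ => hi a⟩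

lemma gridCell_subset_boxBelow (hh : ∀ a, 0 < h a) (i : Fin d → Fin N) :
    gridCell x h i ⊆ boxBelow x (fun a => N * h a) := by
  intro z hz a _
  have hza := hz a (mem_univ a)
  have h1 : ((i a : ℕ) : ℝ) + 1 ≤ N := by exact_mod_cast (i a).2
  have h2 := mul_le_mul_of_nonneg_right h1 (hh a).le
  have h3 : 0 ≤ ((i a : ℕ) : ℝ) * h a := mul_nonneg (Nat.cast_nonneg _) (hh a).le
  exact ⟨by linarith [hza.1], by linarith [hza.2]⟩

lemma measurableSet_gridCell (i : Fin d → Fin N) : MeasurableSet (gridCell x h i) :=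
  MeasurableSet.univ_pi fun _ => measurableSet_Ioc

lemma measurableSet_boxBelow (x s : Fin d → ℝ) : MeasurableSet (boxBelow x s) :=
  MeasurableSet.univ_pi fun _ => measurableSet_Ioc

lemma isBounded_boxBelow (x s : Fin d → ℝ) : Bornology.IsBounded (boxBelow x s) :=
  Bornology.IsBounded.pi fun _ => Metric.isBounded_Ioc _ _

lemma volume_gridCell (hh : ∀ a, 0 < h a) (i : Fin d → Fin N) :
    volume (gridCell x h i) = ENNReal.ofReal (∏ a, h a) := by
  rw [gridCell, Real.volume_pi_Ioc, ENNReal.ofReal_prod_of_nonneg fun a _ => (hh a).le]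
  refine Finset.prod_congr rfl fun a _ => ?_
  congr 1
  ring

lemma volume_biUnion_gridCell (hh : ∀ a, 0 < h a) (T : Finset (Fin d → Fin N)) :
    volume (⋃ i ∈ T, gridCell x h i) = ENNReal.ofReal (T.card * ∏ a, h a) := by
  rw [measure_biUnion_finset]
  · simp only [volume_gridCell hh, Finset.sum_const, nsmul_eq_mul]
    rw [ENNReal.ofReal_mul (by positivity), ENNReal.ofReal_natCast]
  · intro i _ j _ hne
    exact Set.disjoint_left.2 fun z hi hj => hne (eq_of_mem_gridCell hh hi hj)
  · exact fun i _ => measurableSet_gridCell i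

lemma measurableSet_gridSlab (x h : Fin d → ℝ) (a : Fin d) (k : Fin N) :
    MeasurableSet (gridSlab x h a k) :=
  measurable_pi_apply a measurableSet_Ioc

lemma volume_boxBelow_inter_gridSlab_le (hh : ∀ a, 0 < h a) (a : Fin d) (k : Fin N) :
    volume (boxBelow x (fun a => N * h a) ∩ gridSlab x h a k)
      ≤ ENNReal.ofReal ((∏ a, (N * h a)) / N) := by
  have hN : (0 : ℝ) < N := by exact_mod_cast k.pos
  have hsub : boxBelow x (fun a => N * h a) ∩ gridSlab x h a k ⊆ Set.pi univ fun b =>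
      Ioc (if b = a then x a - (k + 1) * h a else x b - N * h b)
        (if b = a then x a - k * h a else x b) := by
    rintro z ⟨hz, hz'⟩ b -
    by_cases hb : b = a
    · subst hb
      simpa [gridSlab] using hz'
    · simpa [hb] using hz b (mem_univ b)
  refine (measure_mono hsub).trans ?_
  rw [Real.volume_pi_Ioc, ← ENNReal.ofReal_prod_of_nonneg]
  · refine ENNReal.ofReal_le_ofReal (le_of_eq ?_)
    have : ∀ b, (if b = a then x a - k * h a else x b)
        - (if b = a then x a - (k + 1) * h a else x b - N * h b)
        = (N * h b) * (if b = a then (N : ℝ)⁻¹ else 1) := by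
      intro b
      split_ifs with hb
      · subst hb
        field_simp
        ring
      · ring
    simp only [this, Finset.prod_mul_distrib, Finset.prod_ite_eq', Finset.mem_univ, if_true]
    rw [div_eq_mul_inv]
  · intro b _
    split_ifs with hb
    · linarith [hh a]
    · have := mul_pos hN (hh b)
      linarith

lemma card_le_chainLength (hA : A.Finite) {C : Finset (Fin d → ℝ)} (hC : ↑C ⊆ A)
    (hc : IsChain (· ≤ ·) (C : Set (Fin d → ℝ))) : C.card ≤ chainLength d A := by
  refine le_csSup ⟨hA.toFinset.card, ?_⟩ ⟨C, hC, hc, rfl⟩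
  rintro n ⟨C', hC', -, rfl⟩
  exact Finset.card_le_card fun z hz => hA.mem_toFinset.2 (hC' hz)

lemma exists_card_eq_chainLength (A : Set (Fin d → ℝ)) :
    ∃ C : Finset (Fin d → ℝ), ↑C ⊆ A ∧ IsChain (· ≤ ·) (C : Set (Fin d → ℝ)) ∧
      C.card = chainLength d A := by
  by_cases hb : BddAbove {n : ℕ | ∃ C : Finset (Fin d → ℝ),
    ↑C ⊆ A ∧ IsChain (· ≤ ·) (C : Set (Fin d → ℝ)) ∧ C.card = n}
  · refine Nat.sSup_mem ?_ hb
    exact ⟨0, ∅, by simp⟩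
  · exact ⟨∅, by simp, by simp, by simp [chainLength, csSup_of_not_bddAbove hb]⟩

lemma chainLength_mono {B : Set (Fin d → ℝ)} (hB : B.Finite) (hAB : A ⊆ B) :
    chainLength d A ≤ chainLength d B := by
  obtain ⟨C, hC, hc, h⟩ := exists_card_eq_chainLength A
  rw [← h]
  exact card_le_chainLength hB (hC.trans hAB) hc

lemma relChainLength_occupied_le (hh : ∀ a, 0 < h a) (hA : A.Finite) :
    relChainLength cellLT (occupied N x h A) ≤ chainLength d A := by
  classical
  obtain ⟨K, hK, hc, hcard⟩ := exists_card_eq_relChainLength cellLT (occupied N x h A)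
  have hne : ∀ i : Fin d → Fin N, ∃ z, i ∈ K → z ∈ A ∩ gridCell x h i := fun i => by
    by_cases hi : i ∈ K
    · obtain ⟨z, hz⟩ := mem_occupied.1 (hK hi)
      exact ⟨z, fun _ => hz⟩
    · exact ⟨0, fun h => absurd h hi⟩
  choose z hz using hne
  have hinj : Set.InjOn z K := fun i hi j hj hij =>
    eq_of_mem_gridCell hh (hz i hi).2 (hij ▸ (hz j hj).2)
  rw [← hcard, ← Finset.card_image_of_injOn hinj]
  have hlt : ∀ i ∈ K, ∀ j ∈ K, cellLT i j → z j ≤ z i := by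
    intro i hi j hj hij a
    have h1 := (hz i hi).2 a (mem_univ a)
    have h2 := (hz j hj).2 a (mem_univ a)
    have h3 : ((i a : ℕ) : ℝ) + 1 ≤ (j a : ℕ) := by exact_mod_cast hij a
    have h4 := mul_le_mul_of_nonneg_right h3 (hh a).le
    linarith [h1.1, h2.2]
  refine card_le_chainLength hA ?_ ?_
  · intro w hw
    obtain ⟨i, hi, rfl⟩ := Finset.mem_image.1 (Finset.mem_coe.1 hw)
    exact (hz i hi).1
  · intro w hw w' hw' hww'
    obtain ⟨i, hi, rfl⟩ := Finset.mem_image.1 (Finset.mem_coe.1 hw)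
    obtain ⟨j, hj, rfl⟩ := Finset.mem_image.1 (Finset.mem_coe.1 hw')
    rcases hc hi hj fun h => hww' (h ▸ rfl) with h | h
    · exact Or.inr (hlt i hi j hj h)
    · exact Or.inl (hlt j hj i hi h)

lemma chainLength_le_relChainLength (hd : 0 < d) (hh : ∀ a, 0 < h a)
    (hA : A ⊆ boxBelow x (fun a => N * h a))
    (hsep : ∀ a, ∀ k : Fin N, (A ∩ gridSlab x h a k).Subsingleton) :
    chainLength d A ≤ relChainLength cellLT (occupied N x h A) := by
  classical
  obtain ⟨C, hC, hc, hcard⟩ := exists_card_eq_chainLength A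
  rw [← hcard]
  rcases C.eq_empty_or_nonempty with rfl | ⟨w, hw⟩
  · simp
  obtain ⟨i₀, -⟩ := exists_mem_gridCell hh (hA (hC hw))
  have hex : ∀ z, ∃ i : Fin d → Fin N, z ∈ A → z ∈ gridCell x h i := fun z => by
    by_cases hz : z ∈ A
    · obtain ⟨i, hi⟩ := exists_mem_gridCell hh (hA hz)
      exact ⟨i, fun _ => hi⟩
    · exact ⟨i₀, fun h => absurd h hz⟩
  choose κ hκ using hex
  have hne : ∀ z ∈ C, ∀ w ∈ C, z ≠ w → ∀ a, κ z a ≠ κ w a := by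
    intro z hz w hw hzw a hab
    refine hzw (hsep a (κ z a) ⟨hC hz, hκ z (hC hz) a (mem_univ a)⟩ ⟨hC hw, ?_⟩)
    rw [hab]
    exact hκ w (hC hw) a (mem_univ a)
  have hinj : Set.InjOn κ C := fun z hz w hw hzw => by_contra fun hne' =>
    hne z hz w hw hne' ⟨0, hd⟩ (congrFun hzw _)
  rw [← Finset.card_image_of_injOn hinj]
  have hlt : ∀ z ∈ C, ∀ w ∈ C, z ≠ w → z ≤ w → cellLT (κ w) (κ z) := by
    intro z hz w hw hzw hle a
    exact lt_of_le_of_ne (lt_of_mem_Ioc_grid (hh a) (hκ z (hC hz) a (mem_univ a))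
      (hκ w (hC hw) a (mem_univ a)) (hle a)) (hne w hw z hz hzw.symm a)
  refine card_le_relChainLength ?_ ?_
  · intro i hi
    obtain ⟨z, hz, rfl⟩ := Finset.mem_image.1 hi
    exact mem_occupied.2 ⟨z, hC hz, hκ z (hC hz)⟩
  · intro i hi j hj hij
    obtain ⟨z, hz, rfl⟩ := Finset.mem_image.1 (Finset.mem_coe.1 hi)
    obtain ⟨w, hw, rfl⟩ := Finset.mem_image.1 (Finset.mem_coe.1 hj)
    have hzw : z ≠ w := fun h => hij (h ▸ rfl)
    rcases hc hz hw hzw with h | h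
    · exact Or.inr (hlt z hz w hw hzw h)
    · exact Or.inl (hlt w hw z hz hzw.symm h)

end Grid

/-- The mean longest strict chain of occupied cells when each of the `N ^ d` cells is occupied
independently with probability `1 - exp (-τ / N ^ d)`. -/
def gridMean (d N : ℕ) (τ : ℝ) : ℝ :=
  bernExp (1 - Real.exp (-(τ / N ^ d))) Finset.univ
    (fun S : Finset (Fin d → Fin N) => (relChainLength cellLT S : ℝ))

/-- The law of `n` independent uniform points of the unit cube. -/
abbrev cubeLaw (d n : ℕ) : Measure (Fin n → Fin d → ℝ) :=
  Measure.pi fun _ => volume.restrict (Set.Icc (0 : Fin d → ℝ) 1)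

/-- The mean longest strict chain of cells occupied by `n` independent uniform points. -/
def cubeGridMean (d N n : ℕ) : ℝ :=
  ∫ X, (relChainLength cellLT (occupied N 1 (fun _ => (N : ℝ)⁻¹) (range X)) : ℝ) ∂cubeLaw d n

section Cube

variable {d N n : ℕ}

instance isProbabilityMeasure_restrict_unitCube :
    IsProbabilityMeasure (volume.restrict (Set.Icc (0 : Fin d → ℝ) 1)) :=
  ⟨by simp [Real.volume_Icc_pi]⟩

lemma restrict_unitCube_eq (hN : 0 < N) :
    volume.restrict (Set.Icc (0 : Fin d → ℝ) 1)
      = volume.restrict (boxBelow 1 (fun _ : Fin d => N * (N : ℝ)⁻¹)) := by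
  refine Measure.restrict_congr_set ?_
  have h := Measure.univ_pi_Ioc_ae_eq_Icc (μ := fun _ : Fin d => (volume : Measure ℝ))
    (f := 0) (g := 1)
  have hN' : (N : ℝ) ≠ 0 := by positivity
  rw [← volume_pi] at h
  simpa [boxBelow, mul_inv_cancel₀ hN'] using h.symm

lemma ae_mem_box (hN : 0 < N) :
    ∀ᵐ X ∂cubeLaw d n, range X ⊆ boxBelow 1 (fun _ : Fin d => N * (N : ℝ)⁻¹) := by
  have h : ∀ j : Fin n, ∀ᵐ X ∂cubeLaw d n, X j ∈ boxBelow 1 (fun _ : Fin d => N * (N : ℝ)⁻¹) := by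
    intro j
    have h1 : ∀ᵐ z ∂volume.restrict (Set.Icc (0 : Fin d → ℝ) 1),
        z ∈ boxBelow 1 (fun _ : Fin d => N * (N : ℝ)⁻¹) := by
      rw [restrict_unitCube_eq hN]
      exact ae_restrict_mem (measurableSet_boxBelow _ _)
    exact (Measure.quasiMeasurePreserving_eval _ j).ae h1
  filter_upwards [ae_all_iff.2 h] with X hX
  rintro _ ⟨j, rfl⟩
  exact hX j

lemma measurableSet_occupied_eq (S : Finset (Fin d → Fin N)) :
    MeasurableSet {X : Fin n → Fin d → ℝ | occupied N 1 (fun _ => (N : ℝ)⁻¹) (range X) = S} := by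
  refine measurableSet_eq_of_forall_mem (fun i => ?_) S
  have : {X : Fin n → Fin d → ℝ | i ∈ occupied N 1 (fun _ => (N : ℝ)⁻¹) (range X)}
      = ⋃ j, (fun X => X j) ⁻¹' gridCell 1 (fun _ => (N : ℝ)⁻¹) i := by
    ext X
    simp only [mem_ofPred_eq, mem_occupied, mem_iUnion, mem_preimage]
    constructor
    · rintro ⟨_, ⟨j, rfl⟩, h⟩
      exact ⟨j, h⟩
    · rintro ⟨j, h⟩
      exact ⟨X j, ⟨j, rfl⟩, h⟩
  rw [this]
  exact MeasurableSet.iUnion fun j => measurable_pi_apply j (measurableSet_gridCell i)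

lemma cubeLaw_occupied_subset (hN : 0 < N) (T : Finset (Fin d → Fin N)) :
    (cubeLaw d n).real {X | occupied N 1 (fun _ => (N : ℝ)⁻¹) (range X) ⊆ T}
      = (T.card / (N : ℝ) ^ d) ^ n := by
  have hh : ∀ a : Fin d, 0 < (fun _ : Fin d => (N : ℝ)⁻¹) a := fun _ => by positivity
  set h : Fin d → ℝ := fun _ => (N : ℝ)⁻¹
  have hae : {X : Fin n → Fin d → ℝ | occupied N 1 h (range X) ⊆ T}
      =ᵐ[cubeLaw d n] Set.pi univ fun _ => ⋃ i ∈ T, gridCell 1 h i := by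
    filter_upwards [ae_mem_box hN] with X hX
    refine propext ⟨fun (hT : occupied N 1 h (range X) ⊆ T) j _ => ?_, fun hT i hi => ?_⟩
    · obtain ⟨i, hi⟩ := exists_mem_gridCell hh (hX ⟨j, rfl⟩)
      exact mem_biUnion (hT (mem_occupied.2 ⟨X j, ⟨j, rfl⟩, hi⟩)) hi
    · obtain ⟨_, ⟨j, rfl⟩, hj⟩ := mem_occupied.1 hi
      obtain ⟨i', hi', hj'⟩ := mem_iUnion₂.1 (hT j (mem_univ j))
      rwa [eq_of_mem_gridCell hh hj hj']
  have hvol : (volume.restrict (Set.Icc (0 : Fin d → ℝ) 1)) (⋃ i ∈ T, gridCell 1 h i)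
      = ENNReal.ofReal (T.card / (N : ℝ) ^ d) := by
    rw [restrict_unitCube_eq hN, Measure.restrict_apply
      (Finset.measurableSet_biUnion _ fun i _ => measurableSet_gridCell i),
      inter_eq_left.2 (iUnion₂_subset fun i _ => gridCell_subset_boxBelow hh i),
      volume_biUnion_gridCell hh]
    simp [h, div_eq_mul_inv]
  rw [measureReal_congr hae, measureReal_def, Measure.pi_pi, hvol]
  simp only [Finset.prod_const, Finset.card_univ, Fintype.card_fin]
  rw [ENNReal.toReal_pow, ENNReal.toReal_ofReal (by positivity)]

lemma chainLength_range_le (X : Fin n → Fin d → ℝ) : chainLength d (range X) ≤ n := by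
  classical
  obtain ⟨C, hC, -, h⟩ := exists_card_eq_chainLength (range X)
  rw [← h]
  calc C.card ≤ (Finset.univ.image X).card := Finset.card_le_card fun z hz => by
        simpa using hC hz
    _ ≤ _ := Finset.card_image_le.trans (by simp)

lemma integrable_relChainLength_occupied :
    Integrable (fun X => (relChainLength cellLT
      (occupied N 1 (fun _ => (N : ℝ)⁻¹) (range X)) : ℝ)) (cubeLaw d n) := by
  let _ : MeasurableSpace (Finset (Fin d → Fin N)) := ⊤
  have hm : Measurable fun X : Fin n → Fin d → ℝ =>
      occupied N 1 (fun _ => (N : ℝ)⁻¹) (range X) :=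
    measurable_to_countable' measurableSet_occupied_eq
  refine Integrable.of_bound (C := Fintype.card (Fin d → Fin N)) ?_ ?_
  · exact ((Measurable.of_discrete
      (f := fun S : Finset (Fin d → Fin N) => (relChainLength cellLT S : ℝ))).comp
        hm).aestronglyMeasurable
  · refine ae_of_all _ fun X => ?_
    rw [Real.norm_natCast]
    exact_mod_cast relChainLength_le_card.trans (Finset.card_le_univ _)

lemma relChainLength_occupied_range_le (hN : 0 < N) (X : Fin n → Fin d → ℝ) :
    relChainLength cellLT (occupied N 1 (fun _ => (N : ℝ)⁻¹) (range X))
      ≤ chainLength d (range X) :=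
  relChainLength_occupied_le (fun _ => by positivity) (finite_range X)

lemma cubeGridMean_nonneg : 0 ≤ cubeGridMean d N n :=
  integral_nonneg fun _ => Nat.cast_nonneg _

lemma cubeGridMean_le (hN : 0 < N) : cubeGridMean d N n ≤ n := by
  have : cubeGridMean d N n ≤ ∫ _, (n : ℝ) ∂cubeLaw d n :=
    integral_mono integrable_relChainLength_occupied (integrable_const _) fun X =>
      Nat.cast_le.2 ((relChainLength_occupied_range_le hN X).trans (chainLength_range_le X))
  simpa using this

lemma cubeGridMean_le_BWexpect (hN : 0 < N) (h : BWexpect d n ≠ 0) :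
    cubeGridMean d N n ≤ BWexpect d n := by
  refine integral_mono integrable_relChainLength_occupied
    (not_imp_comm.1 integral_undef h) fun X => ?_
  exact Nat.cast_le.2 (relChainLength_occupied_range_le hN X)

lemma cubeLaw_same_slab_le (hN : 0 < N) {i j : Fin n} (hij : i ≠ j) (a : Fin d) (k : Fin N) :
    (cubeLaw d n).real {X | X i ∈ gridSlab 1 (fun _ => (N : ℝ)⁻¹) a k ∧
      X j ∈ gridSlab 1 (fun _ => (N : ℝ)⁻¹) a k} ≤ ((N : ℝ)⁻¹) ^ 2 := by
  classical
  set h : Fin d → ℝ := fun _ => (N : ℝ)⁻¹ with hhdef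
  have hh : ∀ a : Fin d, 0 < h a := fun _ => by positivity
  have hset : {X : Fin n → Fin d → ℝ | X i ∈ gridSlab 1 h a k ∧ X j ∈ gridSlab 1 h a k}
      = Set.pi univ fun m => if m = i ∨ m = j then gridSlab 1 h a k else univ := by
    ext X
    constructor
    · rintro ⟨hi, hj⟩ m -
      by_cases hm : m = i ∨ m = j
      · rcases hm with rfl | rfl <;> simpa
      · simp [hm]
    · intro hX
      exact ⟨by simpa using hX i (mem_univ i), by simpa using hX j (mem_univ j)⟩
  have hvol : (volume.restrict (Set.Icc (0 : Fin d → ℝ) 1)) (gridSlab 1 h a k)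
      ≤ ENNReal.ofReal (N : ℝ)⁻¹ := by
    rw [restrict_unitCube_eq hN, Measure.restrict_apply (measurableSet_gridSlab _ _ _ _),
      inter_comm]
    refine (volume_boxBelow_inter_gridSlab_le hh a k).trans (le_of_eq ?_)
    have hN' : (N : ℝ) ≠ 0 := by positivity
    simp [hhdef, mul_inv_cancel₀ hN']
  have hprod : cubeLaw d n {X | X i ∈ gridSlab 1 h a k ∧ X j ∈ gridSlab 1 h a k}
      = (volume.restrict (Set.Icc (0 : Fin d → ℝ) 1)) (gridSlab 1 h a k) ^ 2 := by
    rw [hset, Measure.pi_pi]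
    simp only [apply_ite (volume.restrict (Set.Icc (0 : Fin d → ℝ) 1)), measure_univ]
    rw [Finset.prod_ite, Finset.prod_const_one, mul_one, Finset.prod_const]
    congr 1
    have : (Finset.univ.filter fun m => m = i ∨ m = j) = {i, j} := by
      ext m
      simp
    rw [this, Finset.card_pair hij]
  rw [measureReal_def, hprod, ENNReal.toReal_pow]
  gcongr
  exact ENNReal.toReal_le_of_le_ofReal (by positivity) hvol

lemma BWexpect_le (hd : 0 < d) (hN : 0 < N) :
    BWexpect d n ≤ cubeGridMean d N n + d * (n : ℝ) ^ 3 / N := by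
  classical
  set h : Fin d → ℝ := fun _ => (N : ℝ)⁻¹ with hhdef
  have hh : ∀ a : Fin d, 0 < h a := fun _ => by positivity
  set J : Finset (((Fin n × Fin n) × Fin d) × Fin N) :=
    Finset.univ.filter fun q => q.1.1.1 ≠ q.1.1.2 with hJ
  set E : (((Fin n × Fin n) × Fin d) × Fin N) → Set (Fin n → Fin d → ℝ) := fun q =>
    {X | X q.1.1.1 ∈ gridSlab 1 h q.1.2 q.2 ∧ X q.1.1.2 ∈ gridSlab 1 h q.1.2 q.2} with hE
  have hEm : ∀ q, MeasurableSet (E q) := fun q => by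
    have hpre : ∀ m : Fin n, MeasurableSet
        ((fun X : Fin n → Fin d → ℝ => X m) ⁻¹' gridSlab 1 h q.1.2 q.2) := fun m =>
      measurable_pi_apply m (measurableSet_gridSlab _ _ _ _)
    exact (hpre q.1.1.1).inter (hpre q.1.1.2)
  have hBm : MeasurableSet (⋃ q ∈ J, E q) := Finset.measurableSet_biUnion _ fun q _ => hEm q
  have hBP : (cubeLaw d n).real (⋃ q ∈ J, E q) ≤ d * (n : ℝ) ^ 2 / N := by
    refine (measureReal_biUnion_finset_le _ _).trans ?_
    calc _ ≤ ∑ q ∈ J, ((N : ℝ)⁻¹) ^ 2 := Finset.sum_le_sum fun q hq =>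
          cubeLaw_same_slab_le hN (Finset.mem_filter.1 hq).2 _ _
      _ ≤ ∑ q : (((Fin n × Fin n) × Fin d) × Fin N), ((N : ℝ)⁻¹) ^ 2 :=
          Finset.sum_le_univ_sum_of_nonneg fun q => by positivity
      _ = d * (n : ℝ) ^ 2 / N := by
          simp
          field_simp
  have hle : BWexpect d n ≤ ∫ X, ((relChainLength cellLT (occupied N 1 h (range X)) : ℝ)
      + (⋃ q ∈ J, E q).indicator (fun _ => (n : ℝ)) X) ∂cubeLaw d n := by
    refine integral_mono_of_nonneg (ae_of_all _ fun X => Nat.cast_nonneg _)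
      (integrable_relChainLength_occupied.add ((integrable_const _).indicator hBm)) ?_
    filter_upwards [ae_mem_box hN] with X hX
    by_cases hXB : X ∈ ⋃ q ∈ J, E q
    · rw [indicator_of_mem hXB]
      have : (chainLength d (range X) : ℝ) ≤ n := by exact_mod_cast chainLength_range_le X
      linarith [Nat.cast_nonneg (α := ℝ) (relChainLength cellLT (occupied N 1 h (range X)))]
    · rw [indicator_of_notMem hXB, add_zero]
      refine Nat.cast_le.2 (chainLength_le_relChainLength hd hh hX fun a k => ?_)
      rintro _ ⟨⟨i, rfl⟩, hi⟩ _ ⟨⟨j, rfl⟩, hj⟩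
      by_contra hne
      refine hXB (mem_biUnion (x := ((((i, j), a), k))) ?_ ⟨hi, hj⟩)
      simp only [hJ, Finset.coe_filter, Finset.mem_univ, true_and, mem_ofPred_eq]
      exact fun h => hne (h ▸ rfl)
  rw [integral_add integrable_relChainLength_occupied ((integrable_const _).indicator hBm),
    integral_indicator hBm, setIntegral_const, smul_eq_mul] at hle
  refine hle.trans (add_le_add le_rfl ?_)
  calc _ ≤ d * (n : ℝ) ^ 2 / N * n := by gcongr
    _ = _ := by ring

end Cube

/-- The Poisson weights. -/
def poisWeight (τ : ℝ) (n : ℕ) : ℝ := Real.exp (-τ) * τ ^ n / n.factorial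

section Poisson

variable {τ : ℝ}

lemma poisWeight_nonneg (hτ : 0 ≤ τ) (n : ℕ) : 0 ≤ poisWeight τ n := by
  unfold poisWeight
  positivity

lemma hasSum_poisWeight_mul_pow (τ r : ℝ) :
    HasSum (fun n => poisWeight τ n * r ^ n) (Real.exp (τ * (r - 1))) := by
  have h := (NormedSpace.expSeries_div_hasSum_exp (𝔸 := ℝ) (τ * r)).mul_left (Real.exp (-τ))
  rw [← Real.exp_eq_exp_ℝ, ← Real.exp_add, show -τ + τ * r = τ * (r - 1) by ring] at h
  refine h.congr_fun fun n => ?_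
  rw [poisWeight, mul_pow]
  ring

lemma hasSum_poisWeight (τ : ℝ) : HasSum (poisWeight τ) 1 := by
  simpa using hasSum_poisWeight_mul_pow τ 1

lemma poisWeight_succ_mul (τ : ℝ) (n : ℕ) :
    poisWeight τ (n + 1) * ((n + 1 : ℕ) : ℝ) = τ * poisWeight τ n := by
  rw [poisWeight, poisWeight, Nat.factorial_succ]
  push_cast
  field_simp
  ring

lemma hasSum_poisWeight_mul_id (τ : ℝ) : HasSum (fun n => poisWeight τ n * (n : ℝ)) τ := by
  rw [← hasSum_nat_add_iff' 1]
  simpa [-Nat.cast_add, poisWeight_succ_mul] using (hasSum_poisWeight τ).mul_left τ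

lemma hasSum_poisWeight_mul_sq (τ : ℝ) :
    HasSum (fun n => poisWeight τ n * (n : ℝ) ^ 2) (τ ^ 2 + τ) := by
  rw [← hasSum_nat_add_iff' 1]
  have h := ((hasSum_poisWeight_mul_id τ).mul_left τ).add ((hasSum_poisWeight τ).mul_left τ)
  rw [mul_one, ← sq] at h
  simp only [Finset.range_one, Finset.sum_singleton, Nat.cast_zero, ne_eq, OfNat.ofNat_ne_zero,
    not_false_eq_true, zero_pow, mul_zero, sub_zero]
  refine h.congr_fun fun n => ?_
  rw [sq, ← mul_assoc, poisWeight_succ_mul]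
  push_cast
  ring

lemma hasSum_poisWeight_mul_centered_sq (hτ : 0 < τ) :
    HasSum (fun n => poisWeight τ n * ((n : ℝ) / τ - 1) ^ 2) τ⁻¹ := by
  have h := (((hasSum_poisWeight_mul_sq τ).mul_left (τ ^ 2)⁻¹).add
    ((hasSum_poisWeight_mul_id τ).mul_left (-2 / τ))).add (hasSum_poisWeight τ)
  have e : (τ ^ 2)⁻¹ * (τ ^ 2 + τ) + -2 / τ * τ + 1 = τ⁻¹ := by
    field_simp
    ring
  rw [e] at h
  refine h.congr_fun fun n => ?_
  field_simp
  ring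

end Poisson

section Mean

variable {d N : ℕ} {τ : ℝ}

/-- Poissonization: a Poisson number of uniform points occupies cells independently. -/
lemma hasSum_poisWeight_mul_cubeGridMean (hN : 0 < N) (hτ : 0 ≤ τ) :
    HasSum (fun n => poisWeight τ n * cubeGridMean d N n) (gridMean d N τ) := by
  set q : ℕ → Finset (Fin d → Fin N) → ℝ := fun n S =>
    (cubeLaw d n).real {X | occupied N 1 (fun _ => (N : ℝ)⁻¹) (range X) = S} with hq
  have hsum : ∀ S, Summable fun n => poisWeight τ n * q n S := fun S =>
    Summable.of_nonneg_of_le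
      (fun n => mul_nonneg (poisWeight_nonneg hτ n) measureReal_nonneg)
      (fun n => mul_le_of_le_one_right (poisWeight_nonneg hτ n) measureReal_le_one)
      (hasSum_poisWeight τ).summable
  have hmean : gridMean d N τ = ∑ S, (∑' n, poisWeight τ n * q n S) *
      (relChainLength cellLT S : ℝ) := by
    refine bernExp_univ_eq (fun T => ?_) _
    have h1 : HasSum (fun n => poisWeight τ n * (T.card / (N : ℝ) ^ d) ^ n)
        (∑ S ∈ T.powerset, ∑' n, poisWeight τ n * q n S) := by
      refine (hasSum_sum fun S _ => (hsum S).hasSum).congr_fun fun n => ?_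
      rw [← Finset.mul_sum, ← cubeLaw_occupied_subset hN T,
        ← measureReal_mem_finset measurableSet_occupied_eq]
      simp
    rw [h1.unique (hasSum_poisWeight_mul_pow _ _), sub_sub_cancel, ← Real.exp_nat_mul]
    congr 1
    have h2 : T.card ≤ N ^ d := by
      simpa using Finset.card_le_univ T
    have hN' : (N : ℝ) ^ d ≠ 0 := by positivity
    simp only [Fintype.card_pi, Fintype.card_fin, Finset.prod_const, Finset.card_univ]
    rw [Nat.cast_sub h2]
    push_cast
    field_simp
    ring
  rw [hmean]
  refine (hasSum_sum fun S _ => (hsum S).hasSum.mul_right _).congr_fun fun n => ?_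
  rw [cubeGridMean, integral_comp_eq_sum measurableSet_occupied_eq
    (fun S => (relChainLength cellLT S : ℝ)), Finset.mul_sum]
  exact Finset.sum_congr rfl fun S _ => by rw [mul_assoc]

lemma tendsto_rpow_one_div_atTop (hd : 0 < d) :
    Tendsto (fun τ : ℝ => τ ^ ((1 : ℝ) / d)) atTop atTop :=
  tendsto_rpow_atTop (by positivity)

lemma rpow_eq_mul_div_rpow (hτ : 0 < τ) (n : ℕ) (q : ℝ) :
    (n : ℝ) ^ q = τ ^ q * ((n : ℝ) / τ) ^ q := by
  rw [← Real.mul_rpow hτ.le (by positivity), mul_div_cancel₀ _ hτ.ne']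

lemma eventually_gridMean_le (hd : 0 < d) {c : ℝ} (hc : IsBWConstant d c) {ε : ℝ} (hε : 0 < ε) :
    ∀ᶠ τ in atTop, ∀ N : ℕ, 0 < N → gridMean d N τ ≤ (c + ε) * τ ^ ((1 : ℝ) / d) := by
  obtain ⟨hc0, hlim⟩ := hc
  have hq0 : (0 : ℝ) ≤ 1 / d := by positivity
  have hq1 : (1 : ℝ) / d ≤ 1 := by
    rw [div_le_one (by positivity)]
    exact_mod_cast hd
  have hev : ∀ᶠ n : ℕ in atTop, BWexpect d n ≠ 0 ∧
      BWexpect d n ≤ (c + ε / 2) * (n : ℝ) ^ ((1 : ℝ) / d) := by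
    filter_upwards [hlim.eventually (lt_mem_nhds hc0),
      hlim.eventually (gt_mem_nhds (show c < c + ε / 2 by linarith)), eventually_gt_atTop 0]
      with n h0 h1 hn
    refine ⟨fun h => by simp [h] at h0, ?_⟩
    have hn' : (0 : ℝ) < n := by exact_mod_cast hn
    rw [neg_div, Real.rpow_neg hn'.le, inv_mul_lt_iff₀ (Real.rpow_pos_of_pos hn' _)] at h1
    linarith
  obtain ⟨n₀, hn₀⟩ := eventually_atTop.1 hev
  have hbound : ∀ N : ℕ, 0 < N → ∀ n : ℕ,
      cubeGridMean d N n ≤ n₀ + (c + ε / 2) * (n : ℝ) ^ ((1 : ℝ) / d) := by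
    intro N hN n
    rcases le_or_gt n₀ n with h | h
    · have h1 := cubeGridMean_le_BWexpect hN (hn₀ n h).1
      have h2 := (hn₀ n h).2
      have h3 : (0 : ℝ) ≤ n₀ := Nat.cast_nonneg _
      linarith
    · have h1 := cubeGridMean_le (d := d) (n := n) hN
      have h2 : (n : ℝ) ≤ n₀ := by exact_mod_cast h.le
      have h3 : 0 ≤ (c + ε / 2) * (n : ℝ) ^ ((1 : ℝ) / d) := by positivity
      linarith
  filter_upwards [eventually_gt_atTop 0,
    (tendsto_rpow_one_div_atTop hd).eventually_ge_atTop (2 * n₀ / ε)] with τ hτ hτ2 N hN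
  have hT : 0 < τ ^ ((1 : ℝ) / d) := Real.rpow_pos_of_pos hτ _
  have hmaj := ((hasSum_poisWeight τ).mul_right (n₀ + (c + ε / 2) * τ ^ ((1 : ℝ) / d)
    * (1 - 1 / d))).add ((hasSum_poisWeight_mul_id τ).mul_right
      ((c + ε / 2) * τ ^ ((1 : ℝ) / d) * (1 / d / τ)))
  refine (hasSum_le (fun n => ?_) (hasSum_poisWeight_mul_cubeGridMean hN hτ.le) hmaj).trans ?_
  · rw [mul_assoc (poisWeight τ n), ← mul_add]
    refine mul_le_mul_of_nonneg_left ((hbound N hN n).trans ?_) (poisWeight_nonneg hτ.le n)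
    have h1 : ((n : ℝ) / τ) ^ ((1 : ℝ) / d) ≤ 1 + 1 / d * ((n : ℝ) / τ - 1) := by
      have := rpow_one_add_le_one_add_mul_self (s := (n : ℝ) / τ - 1)
        (by linarith [show 0 ≤ (n : ℝ) / τ by positivity]) hq0 hq1
      simpa using this
    rw [rpow_eq_mul_div_rpow hτ n]
    have h2 := mul_le_mul_of_nonneg_left h1 (show 0 ≤ (c + ε / 2) * τ ^ ((1 : ℝ) / d) by positivity)
    have h3 : (n : ℝ) * ((c + ε / 2) * τ ^ ((1 : ℝ) / d) * (1 / d / τ))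
        = (c + ε / 2) * τ ^ ((1 : ℝ) / d) * (1 / d * (n / τ)) := by ring
    rw [h3]
    linarith
  · have h4 : τ * ((c + ε / 2) * τ ^ ((1 : ℝ) / d) * (1 / d / τ))
        = (c + ε / 2) * τ ^ ((1 : ℝ) / d) * (1 / d) := by
      field_simp
    rw [h4]
    rw [div_le_iff₀ hε] at hτ2
    linarith

lemma eventually_le_gridMean (hd : 0 < d) {c : ℝ} (hc : IsBWConstant d c) {ε : ℝ} (hε : 0 < ε)
    (hεc : ε < c) :
    ∀ᶠ τ in atTop, ∀ᶠ N : ℕ in atTop, (c - ε) * τ ^ ((1 : ℝ) / d) ≤ gridMean d N τ := by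
  obtain ⟨hc0, hlim⟩ := hc
  have hq0 : (0 : ℝ) ≤ 1 / d := by positivity
  have hq1 : (1 : ℝ) / d ≤ 1 := by
    rw [div_le_one (by positivity)]
    exact_mod_cast hd
  have hev : ∀ᶠ n : ℕ in atTop, (c - ε / 4) * (n : ℝ) ^ ((1 : ℝ) / d) ≤ BWexpect d n := by
    filter_upwards [hlim.eventually (lt_mem_nhds (show c - ε / 4 < c by linarith)),
      eventually_gt_atTop 0] with n h1 hn
    have hn' : (0 : ℝ) < n := by exact_mod_cast hn
    rw [neg_div, Real.rpow_neg hn'.le, lt_inv_mul_iff₀ (Real.rpow_pos_of_pos hn' _)] at h1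
    linarith
  obtain ⟨n₀, hn₀⟩ := eventually_atTop.1 hev
  have hbound : ∀ N : ℕ, 0 < N → ∀ n : ℕ,
      (c - ε / 4) * (n : ℝ) ^ ((1 : ℝ) / d) - c * (n₀ + 1) - d * (6 * Real.exp 1 ^ n) / N
        ≤ cubeGridMean d N n := by
    intro N hN n
    have hN' : (0 : ℝ) < N := by exact_mod_cast hN
    rcases le_or_gt n₀ n with h | h
    · have h1 := (hn₀ n h).trans (BWexpect_le hd hN)
      have h2 : 0 ≤ c * ((n₀ : ℝ) + 1) := by positivity
      have h3 : (n : ℝ) ^ 3 ≤ 6 * Real.exp 1 ^ n := by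
        have := Real.pow_div_factorial_le_exp (n : ℝ) (Nat.cast_nonneg n) 3
        rw [div_le_iff₀ (by positivity)] at this
        rw [← Real.exp_nat_mul, mul_one]
        norm_num [Nat.factorial] at this
        linarith
      have h4 : d * (n : ℝ) ^ 3 / N ≤ d * (6 * Real.exp 1 ^ n) / N := by gcongr
      linarith
    · have h1 : (n : ℝ) ^ ((1 : ℝ) / d) ≤ n₀ + 1 := by
        calc (n : ℝ) ^ ((1 : ℝ) / d) ≤ ((n₀ : ℝ) + 1) ^ ((1 : ℝ) / d) := by
              refine Real.rpow_le_rpow (by positivity) ?_ hq0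
              exact_mod_cast (by omega : n ≤ n₀ + 1)
          _ ≤ ((n₀ : ℝ) + 1) ^ (1 : ℝ) :=
              Real.rpow_le_rpow_of_exponent_le (by linarith [Nat.cast_nonneg (α := ℝ) n₀]) hq1
          _ = _ := Real.rpow_one _
      have h2 : (c - ε / 4) * (n : ℝ) ^ ((1 : ℝ) / d) ≤ c * (n₀ + 1) :=
        mul_le_mul (by linarith) h1 (by positivity) hc0.le
      have h3 : 0 ≤ d * (6 * Real.exp 1 ^ n) / N := by positivity
      linarith [cubeGridMean_nonneg (d := d) (N := N) (n := n)]
  set b : ℝ := ε / (8 * c) with hb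
  have hb0 : 0 < b := by positivity
  filter_upwards [eventually_gt_atTop 0, eventually_ge_atTop (1 / b ^ 2),
    (tendsto_rpow_one_div_atTop hd).eventually_ge_atTop (4 * (c * (n₀ + 1)) / ε)]
    with τ hτ hτb hτ2
  have hT : 0 < τ ^ ((1 : ℝ) / d) := Real.rpow_pos_of_pos hτ _
  set T := τ ^ ((1 : ℝ) / d) with hTdef
  have hNlim : Tendsto (fun N : ℕ => d * 6 * Real.exp (τ * (Real.exp 1 - 1)) / (N : ℝ))
      atTop (𝓝 0) := tendsto_const_div_atTop_nhds_zero_nat _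
  filter_upwards [eventually_gt_atTop 0,
    hNlim.eventually (gt_mem_nhds (show 0 < ε / 4 * T by positivity))] with N hN hN2
  have hN' : (0 : ℝ) < N := by exact_mod_cast hN
  have hmin := (((hasSum_poisWeight τ).mul_right ((c - ε / 4) * T * (1 - b) - c * (n₀ + 1))).sub
    ((hasSum_poisWeight_mul_centered_sq hτ).mul_right ((c - ε / 4) * T / b))).sub
      ((hasSum_poisWeight_mul_pow τ (Real.exp 1)).mul_right (d * 6 / (N : ℝ)))
  refine le_trans ?_ (hasSum_le (fun n => ?_) hmin (hasSum_poisWeight_mul_cubeGridMean hN hτ.le))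
  · have h1 : τ⁻¹ / b ≤ b := by
      rw [div_le_iff₀ hb0, inv_le_comm₀ hτ (by positivity)]
      calc (b * b)⁻¹ = 1 / b ^ 2 := by rw [one_div, sq]
        _ ≤ τ := hτb
    rw [div_le_iff₀ hε] at hτ2
    have h2 : (c - ε / 4) * T * (τ⁻¹ / b) ≤ c * T * b := by
      have : 0 ≤ c - ε / 4 := by linarith
      gcongr
      linarith
    have h3 : (c - ε / 4) * T * b ≤ c * T * b := by
      gcongr
      linarith
    have h4 : c * T * b = ε / 8 * T := by
      rw [hb]
      field_simp
    have h5 : Real.exp (τ * (Real.exp 1 - 1)) * (d * 6 / (N : ℝ)) < ε / 4 * T := by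
      calc _ = d * 6 * Real.exp (τ * (Real.exp 1 - 1)) / (N : ℝ) := by ring
        _ < _ := hN2
    have h6 : τ⁻¹ * ((c - ε / 4) * T / b) = (c - ε / 4) * T * (τ⁻¹ / b) := by ring
    rw [h6]
    nlinarith
  · rw [mul_assoc (poisWeight τ n), mul_assoc (poisWeight τ n), ← mul_sub, ← mul_sub]
    refine mul_le_mul_of_nonneg_left (le_trans ?_ (hbound N hN n)) (poisWeight_nonneg hτ.le n)
    set y : ℝ := (n : ℝ) / τ with hy
    have hy0 : 0 ≤ y := by positivity
    have h1 : 1 - b - (y - 1) ^ 2 / b ≤ y ^ ((1 : ℝ) / d) := by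
      have h2 : 1 - y ≤ b + (y - 1) ^ 2 / b := by
        have : (1 - y) * b ≤ b * b + (y - 1) ^ 2 := by
          nlinarith [sq_nonneg (1 - y - b), sq_nonneg (1 - y), sq_nonneg b]
        rw [← sub_le_iff_le_add', le_div_iff₀ hb0]
        linarith
      rcases le_or_gt y 1 with h | h
      · have h3 : y ≤ y ^ ((1 : ℝ) / d) := by
          rcases hy0.eq_or_lt with h0 | h0
          · rw [← h0]
            positivity
          · calc y = y ^ (1 : ℝ) := (Real.rpow_one y).symm
              _ ≤ _ := Real.rpow_le_rpow_of_exponent_ge h0 h hq1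
        linarith
      · have h3 : 1 ≤ y ^ ((1 : ℝ) / d) := Real.one_le_rpow h.le hq0
        have h4 : 0 ≤ (y - 1) ^ 2 / b := by positivity
        linarith
    rw [rpow_eq_mul_div_rpow hτ n, ← hy, ← hTdef]
    have h2 := mul_le_mul_of_nonneg_left h1 (show 0 ≤ (c - ε / 4) * T by
      have : 0 ≤ c - ε / 4 := by linarith
      positivity)
    have h3 : (y - 1) ^ 2 * ((c - ε / 4) * T / b) = (c - ε / 4) * T * ((y - 1) ^ 2 / b) := by ring
    have h4 : Real.exp 1 ^ n * (d * 6 / (N : ℝ)) = d * (6 * Real.exp 1 ^ n) / N := by ring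
    rw [h3, h4]
    linarith

end Mean

section PoissonProcess

variable {d : ℕ} {Ω : Type*} [MeasurableSpace Ω] {P : Measure Ω} {t : ℝ}

lemma isBounded_gridCell {N : ℕ} {x h : Fin d → ℝ} (hh : ∀ a, 0 < h a) (i : Fin d → Fin N) :
    Bornology.IsBounded (gridCell x h i) :=
  (isBounded_boxBelow _ _).subset (gridCell_subset_boxBelow hh i)

namespace PoissonPP

lemma measure_encard_eq (pp : PoissonPP d P fun _ => t) {A : Set (Fin d → ℝ)}
    (hA : MeasurableSet A) (hb : Bornology.IsBounded A) (k : ℕ) :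
    P {ω | (pp.pts ω ∩ A).encard = k} = ENNReal.ofReal (poisWeight (t * volume.real A) k) := by
  rw [pp.poisson A hA hb k, setIntegral_const, smul_eq_mul, mul_comm, poisWeight, mul_comm t]
  congr 1
  ring

lemma measureReal_inter_eq_empty (pp : PoissonPP d P fun _ => t) (ht : 0 < t)
    {A : Set (Fin d → ℝ)} (hA : MeasurableSet A) (hb : Bornology.IsBounded A) :
    P.real {ω | pp.pts ω ∩ A = ∅} = Real.exp (-(t * volume.real A)) := by
  have h := pp.measure_encard_eq hA hb 0
  simp only [Nat.cast_zero, encard_eq_zero] at h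
  rw [measureReal_def, h, ENNReal.toReal_ofReal (poisWeight_nonneg (by positivity) _)]
  simp [poisWeight]

lemma measurableSet_inter_eq_empty (pp : PoissonPP d P fun _ => t)
    {A : Set (Fin d → ℝ)} (hA : MeasurableSet A) (hb : Bornology.IsBounded A) :
    MeasurableSet {ω | pp.pts ω ∩ A = ∅} := by
  simpa only [Nat.cast_zero, encard_eq_zero] using pp.measur A hA hb 0

lemma ae_finite_inter [IsProbabilityMeasure P] (pp : PoissonPP d P fun _ => t) (ht : 0 < t)
    {A : Set (Fin d → ℝ)} (hA : MeasurableSet A) (hb : Bornology.IsBounded A) :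
    ∀ᵐ ω ∂P, (pp.pts ω ∩ A).Finite := by
  have hU : P (⋃ k : ℕ, {ω | (pp.pts ω ∩ A).encard = k}) = 1 := by
    rw [measure_iUnion _ fun k => pp.measur A hA hb k]
    · simp only [pp.measure_encard_eq hA hb]
      rw [← ENNReal.ofReal_tsum_of_nonneg (fun k => poisWeight_nonneg (by positivity) k)
        (hasSum_poisWeight _).summable, (hasSum_poisWeight _).tsum_eq, ENNReal.ofReal_one]
    · intro k l hkl
      refine Set.disjoint_left.2 fun ω hk hl => hkl ?_
      have := hk.symm.trans hl
      exact_mod_cast this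
  have hm : MeasurableSet (⋃ k : ℕ, {ω | (pp.pts ω ∩ A).encard = k}) :=
    MeasurableSet.iUnion fun k => pp.measur A hA hb k
  have h0 := (prob_compl_eq_zero_iff hm).2 hU
  filter_upwards [compl_mem_ae_iff.2 h0] with ω hω
  simp only [compl_compl, mem_iUnion, mem_ofPred_eq] at hω
  obtain ⟨k, hk⟩ := hω
  exact finite_of_encard_eq_coe hk

lemma measure_not_subsingleton_le [IsProbabilityMeasure P] (pp : PoissonPP d P fun _ => t)
    (ht : 0 < t) {A : Set (Fin d → ℝ)} (hA : MeasurableSet A) (hb : Bornology.IsBounded A) :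
    P {ω | ¬ (pp.pts ω ∩ A).Subsingleton} ≤ ENNReal.ofReal ((t * volume.real A) ^ 2) := by
  set y := t * volume.real A with hy
  have hy0 : 0 ≤ y := by positivity
  set E : ℕ → Set Ω := fun k => {ω | (pp.pts ω ∩ A).encard = k} with hE
  have hmE : ∀ k, MeasurableSet (E k) := fun k => pp.measur A hA hb k
  have hreal : ∀ k, P.real (E k) = poisWeight y k := fun k => by
    rw [measureReal_def, pp.measure_encard_eq hA hb k,
      ENNReal.toReal_ofReal (poisWeight_nonneg hy0 _)]
  have hsub : {ω | ¬ (pp.pts ω ∩ A).Subsingleton} ⊆ (E 0 ∪ E 1)ᶜ := by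
    intro ω hω h
    refine hω (encard_le_one_iff_subsingleton.1 ?_)
    rcases h with h | h
    · simp only [hE, mem_ofPred_eq] at h
      rw [h]
      simp
    · simp only [hE, mem_ofPred_eq] at h
      rw [h]
      simp
  refine (measure_mono hsub).trans ?_
  rw [← ofReal_measureReal]
  refine ENNReal.ofReal_le_ofReal ?_
  have hdisj : Disjoint (E 0) (E 1) := Set.disjoint_left.2 fun ω h0 h1 => by
    have := h0.symm.trans h1
    exact absurd this (by simp)
  rw [probReal_compl_eq_one_sub ((hmE 0).union (hmE 1)),
    measureReal_union hdisj (hmE 1), hreal, hreal]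
  simp only [poisWeight, pow_zero, mul_one, Nat.factorial_zero, Nat.cast_one, div_one, pow_one,
    Nat.factorial_one]
  nlinarith [Real.add_one_le_exp (-y), mul_le_mul_of_nonneg_right (Real.add_one_le_exp (-y))
    (show 0 ≤ 1 + y by linarith)]

section Grid

variable (pp : PoissonPP d P fun _ => t) {N : ℕ} {x h : Fin d → ℝ}

lemma mem_occupied_iff (hh : ∀ a, 0 < h a) (ω : Ω) (i : Fin d → Fin N) :
    i ∈ occupied N x h (pp.pts ω ∩ boxBelow x (fun a => N * h a)) ↔
      (pp.pts ω ∩ gridCell x h i).Nonempty := by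
  rw [mem_occupied, inter_assoc, inter_eq_right.2 (gridCell_subset_boxBelow hh i)]

lemma measurableSet_occupied_eq (hh : ∀ a, 0 < h a) (S : Finset (Fin d → Fin N)) :
    MeasurableSet {ω | occupied N x h (pp.pts ω ∩ boxBelow x (fun a => N * h a)) = S} := by
  refine measurableSet_eq_of_forall_mem (fun i => ?_) S
  simp only [pp.mem_occupied_iff hh, nonempty_iff_ne_empty]
  exact (pp.measurableSet_inter_eq_empty (measurableSet_gridCell i)
    (isBounded_gridCell hh i)).compl

lemma measureReal_occupied_subset (ht : 0 < t) (hN : 0 < N) (hh : ∀ a, 0 < h a)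
    (T : Finset (Fin d → Fin N)) :
    P.real {ω | occupied N x h (pp.pts ω ∩ boxBelow x (fun a => N * h a)) ⊆ T}
      = (1 - (1 - Real.exp (-((t * ∏ a, (N * h a)) / N ^ d))))
        ^ (Fintype.card (Fin d → Fin N) - T.card) := by
  classical
  have hset : {ω | occupied N x h (pp.pts ω ∩ boxBelow x (fun a => N * h a)) ⊆ T}
      = {ω | pp.pts ω ∩ (⋃ i ∈ Tᶜ, gridCell x h i) = ∅} := by
    ext ω
    simp only [mem_ofPred_eq, Finset.subset_iff, pp.mem_occupied_iff hh, eq_empty_iff_forall_notMem,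
      mem_inter_iff, mem_iUnion, Finset.mem_compl, not_and, not_exists]
    constructor
    · intro H z hz i hi hzi
      exact hi (H ⟨z, hz, hzi⟩)
    · rintro H i ⟨z, hz, hzi⟩
      by_contra hi
      exact H z hz i hi hzi
  have hm : MeasurableSet (⋃ i ∈ Tᶜ, gridCell x h i) :=
    Finset.measurableSet_biUnion _ fun i _ => measurableSet_gridCell i
  have hb : Bornology.IsBounded (⋃ i ∈ Tᶜ, gridCell x h i) :=
    (Bornology.isBounded_biUnion_finset _).2 fun i _ => isBounded_gridCell hh i
  have hp : 0 ≤ ∏ a, h a := Finset.prod_nonneg fun a _ => (hh a).le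
  have hN' : (N : ℝ) ^ d ≠ 0 := by positivity
  rw [hset, pp.measureReal_inter_eq_empty ht hm hb, measureReal_def,
    volume_biUnion_gridCell hh, ENNReal.toReal_ofReal (by positivity), Finset.card_compl,
    sub_sub_cancel, ← Real.exp_nat_mul, Finset.prod_mul_distrib, Finset.prod_const,
    Finset.card_univ, Fintype.card_fin]
  congr 1
  field_simp

variable [IsProbabilityMeasure P]

lemma measure_occupied_mem_le (ht : 0 < t) (hN : 0 < N) (hh : ∀ a, 0 < h a) {s : ℝ} (hs : 0 < s)
    (a : ℝ) (F : Finset (Finset (Fin d → Fin N)))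
    (hF : ∀ S ∈ F, a * Real.log s ≤ relChainLength cellLT S * Real.log s) :
    P {ω | occupied N x h (pp.pts ω ∩ boxBelow x (fun a => N * h a)) ∈ F} ≤
      ENNReal.ofReal (Real.exp ((s - 1) * gridMean d N (t * ∏ a, (N * h a)) - a * Real.log s)) := by
  have hpr : 0 ≤ ∏ a, (N * h a) :=
    Finset.prod_nonneg fun a _ => mul_nonneg (Nat.cast_nonneg _) (hh a).le
  refine measure_relChainLength_le (pp.measurableSet_occupied_eq hh) ?_ ?_
    (pp.measureReal_occupied_subset ht hN hh) _ hs a F hF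
  · rw [sub_nonneg, Real.exp_le_one_iff]
    have : 0 ≤ t * (∏ a, (N * h a)) / (N : ℝ) ^ d := by positivity
    linarith
  · linarith [Real.exp_pos (-(t * (∏ a, (N * h a)) / (N : ℝ) ^ d))]

lemma measure_grid_not_separated_le (ht : 0 < t) (hN : 0 < N) (hh : ∀ a, 0 < h a) :
    P {ω | ¬ ∀ a, ∀ k : Fin N,
      (pp.pts ω ∩ boxBelow x (fun a => N * h a) ∩ gridSlab x h a k).Subsingleton}
      ≤ ENNReal.ofReal (d * (t * ∏ a, (N * h a)) ^ 2 / N) := by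
  set τ := t * ∏ a, (N * h a) with hτ
  have hpr : 0 ≤ ∏ a, (N * h a) :=
    Finset.prod_nonneg fun a _ => mul_nonneg (Nat.cast_nonneg _) (hh a).le
  have hset : {ω | ¬ ∀ a, ∀ k : Fin N,
      (pp.pts ω ∩ boxBelow x (fun a => N * h a) ∩ gridSlab x h a k).Subsingleton}
      = ⋃ q ∈ (Finset.univ : Finset (Fin d × Fin N)),
        {ω | ¬ (pp.pts ω ∩
          (boxBelow x (fun a => N * h a) ∩ gridSlab x h q.1 q.2)).Subsingleton} := by
    ext ω
    simp [inter_assoc]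
  rw [hset]
  refine (measure_biUnion_finset_le _ _).trans ?_
  have hq : ∀ q ∈ (Finset.univ : Finset (Fin d × Fin N)),
      P {ω | ¬ (pp.pts ω ∩ (boxBelow x (fun a => N * h a) ∩ gridSlab x h q.1 q.2)).Subsingleton}
        ≤ ENNReal.ofReal ((τ / N) ^ 2) := by
    intro q _
    refine (pp.measure_not_subsingleton_le ht
      ((measurableSet_boxBelow _ _).inter (measurableSet_gridSlab _ _ _ _))
      ((isBounded_boxBelow _ _).subset inter_subset_left)).trans (ENNReal.ofReal_le_ofReal ?_)
    have hv : volume.real (boxBelow x (fun a => N * h a) ∩ gridSlab x h q.1 q.2)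
        ≤ (∏ a, (N * h a)) / N :=
      ENNReal.toReal_le_of_le_ofReal (by positivity) (volume_boxBelow_inter_gridSlab_le hh q.1 q.2)
    rw [hτ, mul_div_assoc]
    gcongr
  refine (Finset.sum_le_sum hq).trans (le_of_eq ?_)
  rw [Finset.sum_const, Finset.card_univ, Fintype.card_prod, Fintype.card_fin, Fintype.card_fin,
    nsmul_eq_mul, ← ENNReal.ofReal_natCast, ← ENNReal.ofReal_mul (by positivity)]
  congr 1
  push_cast
  field_simp

end Grid

variable [IsProbabilityMeasure P] (pp : PoissonPP d P fun _ => t) {x w : Fin d → ℝ}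

/-- Upper tail of the longest chain in a box. -/
lemma measure_le_chainLength_boxBelow_le (hd : 0 < d) (ht : 0 < t) (hw : ∀ a, 0 < w a) {s : ℝ}
    (hs : 1 < s) (a : ℝ) {M : ℝ} (hM : ∀ N, 0 < N → gridMean d N (t * ∏ a, w a) ≤ M) :
    P {ω | a ≤ chainLength d (pp.pts ω ∩ boxBelow x w)} ≤
      ENNReal.ofReal (Real.exp ((s - 1) * M - a * Real.log s)) := by
  classical
  set B := Real.exp ((s - 1) * M - a * Real.log s) with hB
  have key : ∀ᶠ N : ℕ in atTop, P {ω | a ≤ chainLength d (pp.pts ω ∩ boxBelow x w)} ≤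
      ENNReal.ofReal (B + d * (t * ∏ a, w a) ^ 2 / N) := by
    filter_upwards [eventually_gt_atTop 0] with N hN
    have hN' : (0 : ℝ) < N := by exact_mod_cast hN
    obtain ⟨h, hh, rfl⟩ : ∃ h : Fin d → ℝ, (∀ a, 0 < h a) ∧ w = fun a => N * h a :=
      ⟨fun a => w a / N, fun a => div_pos (hw a) hN', by ext a; field_simp⟩
    have hsub : {ω | a ≤ chainLength d (pp.pts ω ∩ boxBelow x (fun a => N * h a))} ⊆
        {ω | occupied N x h (pp.pts ω ∩ boxBelow x (fun a => N * h a)) ∈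
          Finset.univ.filter fun S : Finset (Fin d → Fin N) => a ≤ relChainLength cellLT S} ∪
        {ω | ¬ ∀ a, ∀ k : Fin N,
          (pp.pts ω ∩ boxBelow x (fun a => N * h a) ∩ gridSlab x h a k).Subsingleton} := by
      intro ω hω
      by_cases hsep : ∀ a, ∀ k : Fin N,
          (pp.pts ω ∩ boxBelow x (fun a => N * h a) ∩ gridSlab x h a k).Subsingleton
      · left
        simp only [mem_ofPred_eq, Finset.mem_filter, Finset.mem_univ, true_and] at hω ⊢
        refine hω.trans ?_
        exact_mod_cast chainLength_le_relChainLength hd hh inter_subset_right hsep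
      · exact Or.inr hsep
    refine (measure_mono hsub).trans ((measure_union_le _ _).trans ?_)
    rw [ENNReal.ofReal_add (Real.exp_pos _).le (by positivity)]
    refine add_le_add ?_ (pp.measure_grid_not_separated_le ht hN hh)
    refine (pp.measure_occupied_mem_le ht hN hh (zero_lt_one.trans hs) a _ ?_).trans
      (ENNReal.ofReal_le_ofReal (Real.exp_le_exp.2 ?_))
    · intro S hS
      exact mul_le_mul_of_nonneg_right (Finset.mem_filter.1 hS).2 (Real.log_nonneg hs.le)
    · exact sub_le_sub_right (mul_le_mul_of_nonneg_left (hM N hN) (by linarith)) _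
  have hlim : Tendsto (fun N : ℕ => ENNReal.ofReal (B + d * (t * ∏ a, w a) ^ 2 / N)) atTop
      (𝓝 (ENNReal.ofReal B)) := by
    refine ENNReal.tendsto_ofReal ?_
    simpa using (tendsto_const_div_atTop_nhds_zero_nat (d * (t * ∏ a, w a) ^ 2)).const_add B
  exact ge_of_tendsto hlim key

/-- Lower tail of the longest chain in a box. -/
lemma measure_chainLength_boxBelow_le_le (ht : 0 < t) (hw : ∀ a, 0 < w a) {s : ℝ}
    (hs0 : 0 < s) (hs1 : s < 1) (a : ℝ) {m : ℝ} {N : ℕ} (hN : 0 < N)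
    (hm : m ≤ gridMean d N (t * ∏ a, w a)) :
    P {ω | (chainLength d (pp.pts ω ∩ boxBelow x w) : ℝ) ≤ a} ≤
      ENNReal.ofReal (Real.exp ((s - 1) * m - a * Real.log s)) := by
  classical
  have hN' : (0 : ℝ) < N := by exact_mod_cast hN
  obtain ⟨h, hh, rfl⟩ : ∃ h : Fin d → ℝ, (∀ a, 0 < h a) ∧ w = fun a => N * h a :=
    ⟨fun a => w a / N, fun a => div_pos (hw a) hN', by ext a; field_simp⟩
  have hle : P {ω | (chainLength d (pp.pts ω ∩ boxBelow x (fun a => N * h a)) : ℝ) ≤ a} ≤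
      P {ω | occupied N x h (pp.pts ω ∩ boxBelow x (fun a => N * h a)) ∈
        Finset.univ.filter fun S : Finset (Fin d → Fin N) =>
          (relChainLength cellLT S : ℝ) ≤ a} := by
    refine measure_mono_ae ?_
    filter_upwards [pp.ae_finite_inter ht (measurableSet_boxBelow x fun a => N * h a)
      (isBounded_boxBelow _ _)] with ω hfin hω
    simp only [Finset.mem_filter, Finset.mem_univ, true_and]
    refine le_trans ?_ hω
    exact_mod_cast relChainLength_occupied_le hh hfin
  refine hle.trans ((pp.measure_occupied_mem_le ht hN hh hs0 a _ ?_).trans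
      (ENNReal.ofReal_le_ofReal (Real.exp_le_exp.2 ?_)))
  · intro S hS
    exact mul_le_mul_of_nonpos_right (Finset.mem_filter.1 hS).2 (Real.log_nonpos hs0.le hs1.le)
  · exact sub_le_sub_right (mul_le_mul_of_nonpos_left hm (by linarith)) _

end PoissonPP

end PoissonProcess

section BoxTails

variable {d : ℕ} {Ω : Type*} [MeasurableSpace Ω]

/-- Exponential upper tail bound for boxes. -/
lemma eventually_measure_le_chainLength_boxBelow (hd : 0 < d) {c : ℝ} (hc : IsBWConstant d c)
    (P : Measure Ω) [IsProbabilityMeasure P]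
    (x : Fin d → ℝ) {w : Fin d → ℝ} (hw : ∀ a, 0 < w a) {ε : ℝ} (hε : 0 < ε) :
    ∃ δ > 0, ∀ᶠ t : ℝ in atTop, ∀ pp : PoissonPP d P fun _ => t,
      P {ω | (c * (∏ a, w a) ^ ((1 : ℝ) / d) + ε) * t ^ ((1 : ℝ) / d)
        ≤ chainLength d (pp.pts ω ∩ boxBelow x w)}
        ≤ ENNReal.ofReal (Real.exp (-δ * t ^ ((1 : ℝ) / d))) := by
  have hV : 0 < ∏ a, w a := Finset.prod_pos fun a _ => hw a
  set W := (∏ a, w a) ^ ((1 : ℝ) / d) with hW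
  have hW0 : 0 < W := Real.rpow_pos_of_pos hV _
  have hb0 : 0 < c * W := mul_pos hc.1 hW0
  set η := ε / (4 * (c * W + ε)) with hη
  have hη0 : 0 < η := by positivity
  have hε' : 0 < ε / (2 * W) := by positivity
  refine ⟨η * ε / 4, by positivity, ?_⟩
  filter_upwards [eventually_gt_atTop 0, (tendsto_id.atTop_mul_const hV).eventually
    (eventually_gridMean_le hd hc hε')] with t ht hM pp
  refine (pp.measure_le_chainLength_boxBelow_le hd ht hw (s := 1 + η) (by linarith) _ hM).trans
    (ENNReal.ofReal_le_ofReal (Real.exp_le_exp.2 ?_))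
  simp only [id]
  rw [Real.mul_rpow ht.le hV.le, ← hW]
  set T := t ^ ((1 : ℝ) / d) with hT
  have hT0 : 0 ≤ T := Real.rpow_nonneg ht.le _
  have hlog : η - η ^ 2 ≤ Real.log (1 + η) := by
    refine le_trans ?_ (Real.one_sub_inv_le_log_of_pos (by linarith))
    rw [le_sub_iff_add_le, ← le_sub_iff_add_le', inv_le_iff_one_le_mul₀ (by linarith)]
    nlinarith [pow_pos hη0 3]
  have h1 : (c + ε / (2 * W)) * (T * W) = (c * W + ε / 2) * T := by
    field_simp
  have h2 : (c * W + ε) * η = ε / 4 := by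
    rw [hη]
    field_simp
  have h3 : (c * W + ε) * (η - η ^ 2) = η * (c * W + ε) - η * (ε / 4) := by
    rw [← h2]
    ring
  have h4 := mul_le_mul_of_nonneg_left hlog (show 0 ≤ c * W + ε by linarith)
  have h5 := mul_le_mul_of_nonneg_right h4 hT0
  rw [h1]
  rw [h3] at h5
  linarith

/-- Exponential lower tail bound for boxes. -/
lemma eventually_measure_chainLength_boxBelow_le (hd : 0 < d) {c : ℝ} (hc : IsBWConstant d c)
    (P : Measure Ω) [IsProbabilityMeasure P]
    (x : Fin d → ℝ) {w : Fin d → ℝ} (hw : ∀ a, 0 < w a) {ε : ℝ} (hε : 0 < ε)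
    (hεc : ε < c * (∏ a, w a) ^ ((1 : ℝ) / d)) :
    ∃ δ > 0, ∀ᶠ t : ℝ in atTop, ∀ pp : PoissonPP d P fun _ => t,
      P {ω | (chainLength d (pp.pts ω ∩ boxBelow x w) : ℝ)
        ≤ (c * (∏ a, w a) ^ ((1 : ℝ) / d) - ε) * t ^ ((1 : ℝ) / d)}
        ≤ ENNReal.ofReal (Real.exp (-δ * t ^ ((1 : ℝ) / d))) := by
  have hV : 0 < ∏ a, w a := Finset.prod_pos fun a _ => hw a
  set W := (∏ a, w a) ^ ((1 : ℝ) / d) with hW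
  have hW0 : 0 < W := Real.rpow_pos_of_pos hV _
  have hb0 : 0 < c * W := mul_pos hc.1 hW0
  set η := ε / (4 * (c * W)) with hη
  have hη0 : 0 < η := by positivity
  have hη1 : η < 1 := by
    rw [hη, div_lt_one (by positivity)]
    linarith
  have hε' : 0 < ε / (2 * W) := by positivity
  have hεc' : ε / (2 * W) < c := by
    rw [div_lt_iff₀ (by positivity)]
    nlinarith
  refine ⟨η * ε / 4, by positivity, ?_⟩
  filter_upwards [eventually_gt_atTop 0, (tendsto_id.atTop_mul_const hV).eventually
    (eventually_le_gridMean hd hc hε' hεc')] with t ht hm pp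
  obtain ⟨N, hmN, hN⟩ := (hm.and (eventually_gt_atTop 0)).exists
  refine (pp.measure_chainLength_boxBelow_le_le ht hw (s := 1 - η) (by linarith) (by linarith)
    _ hN hmN).trans (ENNReal.ofReal_le_ofReal (Real.exp_le_exp.2 ?_))
  simp only [id]
  rw [Real.mul_rpow ht.le hV.le, ← hW]
  set T := t ^ ((1 : ℝ) / d) with hT
  have hT0 : 0 ≤ T := Real.rpow_nonneg ht.le _
  have hlog : -Real.log (1 - η) * (1 - η) ≤ η := by
    have h := Real.one_sub_inv_le_log_of_pos (show 0 < 1 - η by linarith)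
    have h' := mul_le_mul_of_nonneg_right h (show 0 ≤ 1 - η by linarith)
    rw [sub_mul, inv_mul_cancel₀ (by linarith)] at h'
    linarith
  have h1 : (c - ε / (2 * W)) * (T * W) = (c * W - ε / 2) * T := by
    field_simp
  have h2 : c * W * η = ε / 4 := by
    rw [hη, mul_div_assoc', mul_comm (c * W), mul_div_mul_right _ _ hb0.ne']
  have hl0 : 0 ≤ -Real.log (1 - η) := by
    linarith [Real.log_nonpos (show 0 ≤ 1 - η by linarith) (by linarith)]
  have h3 : c * W - ε ≤ (c * W - 3 * ε / 4) * (1 - η) := by nlinarith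
  have h4 : (c * W - ε) * -Real.log (1 - η) ≤ (c * W - 3 * ε / 4) * η := by
    calc _ ≤ (c * W - 3 * ε / 4) * (1 - η) * -Real.log (1 - η) :=
          mul_le_mul_of_nonneg_right h3 hl0
      _ = (c * W - 3 * ε / 4) * (-Real.log (1 - η) * (1 - η)) := by ring
      _ ≤ _ := mul_le_mul_of_nonneg_left hlog (by linarith)
  have h5 := mul_le_mul_of_nonneg_right h4 hT0
  rw [h1]
  linarith

end BoxTails

section Simplex

variable {d : ℕ} {x v : Fin d → ℝ}

lemma boxBelow_subset_simplexS (hd : 0 < d) (hv : ∀ i, 0 < v i) :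
    boxBelow x (fun i => 1 / (d * v i)) ⊆ simplexS d x v := by
  intro z hz
  refine ⟨fun i => (hz i (mem_univ i)).2, ?_⟩
  have hd' : (0 : ℝ) < d := by exact_mod_cast hd
  calc ∑ i, (x i - z i) * v i ≤ ∑ _i : Fin d, 1 / (d : ℝ) := by
        refine Finset.sum_le_sum fun i _ => ?_
        have h1 : x i - z i ≤ 1 / (d * v i) := by linarith [(hz i (mem_univ i)).1]
        have h2 := mul_le_mul_of_nonneg_right h1 (hv i).le
        have h3 : 1 / (d * v i) * v i = 1 / (d : ℝ) := by
          have := (hv i).ne'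
          field_simp
        linarith
    _ = 1 := by
        rw [Finset.sum_const, Finset.card_univ, Fintype.card_fin, nsmul_eq_mul]
        field_simp

lemma mul_le_one_of_mem_simplexS (hv : ∀ i, 0 < v i) {z : Fin d → ℝ} (hz : z ∈ simplexS d x v)
    (i : Fin d) : (x i - z i) * v i ≤ 1 :=
  (Finset.single_le_sum (f := fun i => (x i - z i) * v i)
    (fun j _ => mul_nonneg (sub_nonneg.2 (hz.1 j)) (hv j).le) (Finset.mem_univ i)).trans hz.2

lemma simplexS_subset_boxBelow (hv : ∀ i, 0 < v i) :
    simplexS d x v ⊆ boxBelow x (fun i => 2 / v i) := by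
  intro z hz i _
  refine ⟨?_, hz.1 i⟩
  have h1 := mul_le_one_of_mem_simplexS hv hz i
  have h2 : x i - z i < 2 / v i := by
    rw [lt_div_iff₀ (hv i)]
    linarith
  linarith

/-- The side lengths of the boxes which cover the intervals below `x` inside the simplex. -/
def coverSide (v : Fin d → ℝ) (K : ℕ) (k : Fin d → Fin (K + 1)) (i : Fin d) : ℝ :=
  (k i + 1) / (K * v i)

lemma coverSide_pos (hv : ∀ i, 0 < v i) {K : ℕ} (hK : 0 < K) (k : Fin d → Fin (K + 1))
    (i : Fin d) : 0 < coverSide v K k i := by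
  have := hv i
  unfold coverSide
  positivity

/-- A point of the simplex spans with `x` an interval lying in one of finitely many boxes. -/
lemma exists_Icc_subset_coverSide (hv : ∀ i, 0 < v i) {K : ℕ} (hK : 0 < K) {z : Fin d → ℝ}
    (hz : z ∈ simplexS d x v) :
    ∃ k : Fin d → Fin (K + 1), ∑ i, (k i : ℝ) ≤ K ∧ Icc z x ⊆ boxBelow x (coverSide v K k) := by
  have hK' : (0 : ℝ) < K := by exact_mod_cast hK
  have h0 : ∀ i, 0 ≤ (x i - z i) * v i * K := fun i =>
    mul_nonneg (mul_nonneg (sub_nonneg.2 (hz.1 i)) (hv i).le) hK'.le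
  have hlt : ∀ i, ⌊(x i - z i) * v i * K⌋₊ < K + 1 := fun i => by
    rw [Nat.lt_succ_iff]
    refine Nat.floor_le_of_le ?_
    nlinarith [mul_le_one_of_mem_simplexS hv hz i]
  refine ⟨fun i => ⟨⌊(x i - z i) * v i * K⌋₊, hlt i⟩, ?_, ?_⟩
  · calc _ ≤ ∑ i, (x i - z i) * v i * K := Finset.sum_le_sum fun i _ => Nat.floor_le (h0 i)
      _ = (∑ i, (x i - z i) * v i) * K := by rw [Finset.sum_mul]
      _ ≤ 1 * K := mul_le_mul_of_nonneg_right hz.2 hK'.le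
      _ = K := one_mul _
  · intro y hy i _
    refine ⟨?_, hy.2 i⟩
    have h1 : x i - z i < coverSide v K
        (fun i => ⟨⌊(x i - z i) * v i * K⌋₊, hlt i⟩) i := by
      rw [coverSide, lt_div_iff₀ (mul_pos hK' (hv i))]
      have := Nat.lt_floor_add_one ((x i - z i) * v i * K)
      simp only
      linarith
    linarith [hy.1 i]

lemma IsChain.exists_least {C : Finset (Fin d → ℝ)}
    (hc : IsChain (· ≤ ·) (C : Set (Fin d → ℝ))) (hne : C.Nonempty) :
    ∃ z ∈ C, ∀ y ∈ C, z ≤ y := by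
  obtain ⟨z, hz⟩ := C.exists_minimal hne
  refine ⟨z, hz.1, fun y hy => ?_⟩
  rcases hc.total hz.1 hy with h | h
  · exact h
  · exact hz.2 hy h

lemma exists_chainLength_simplexS_le (hv : ∀ i, 0 < v i) {K : ℕ} (hK : 0 < K)
    {A : Set (Fin d → ℝ)} (hA : ∀ k, (A ∩ boxBelow x (coverSide v K k)).Finite) :
    ∃ k : Fin d → Fin (K + 1), ∑ i, (k i : ℝ) ≤ K ∧
      chainLength d (A ∩ simplexS d x v) ≤ chainLength d (A ∩ boxBelow x (coverSide v K k)) := by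
  obtain ⟨C, hC, hc, hcard⟩ := exists_card_eq_chainLength (A ∩ simplexS d x v)
  rw [← hcard]
  rcases C.eq_empty_or_nonempty with rfl | hne
  · exact ⟨0, by simp, by simp⟩
  · obtain ⟨z, hzC, hzmin⟩ := hc.exists_least hne
    obtain ⟨k, hk, hsub⟩ := exists_Icc_subset_coverSide hv hK (hC hzC).2
    exact ⟨k, hk, card_le_chainLength (hA k)
      (fun y hy => ⟨(hC hy).1, hsub ⟨hzmin y hy, (hC hy).2.1⟩⟩) hc⟩

lemma prod_rpow_one_div_le (hd : 0 < d) {K : ℕ} (hK : 0 < K) (hv : ∀ i, 0 < v i)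
    {k : Fin d → Fin (K + 1)} (hk : ∑ i, (k i : ℝ) ≤ K) :
    (∏ i, coverSide v K k i) ^ ((1 : ℝ) / d)
      ≤ 1 / (d * (∏ i, v i) ^ ((1 : ℝ) / d)) * (1 + d / K) := by
  have hd' : (0 : ℝ) < d := by exact_mod_cast hd
  have hK' : (0 : ℝ) < K := by exact_mod_cast hK
  have hV : 0 < ∏ i, v i := Finset.prod_pos fun i _ => hv i
  have hnum : ∀ i ∈ Finset.univ, 0 ≤ ((k i : ℝ) + 1) / K := fun i _ => by positivity
  have hsplit : ∏ i, coverSide v K k i = (∏ i, ((k i : ℝ) + 1) / K) / ∏ i, v i := by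
    rw [← Finset.prod_div_distrib]
    exact Finset.prod_congr rfl fun i _ => by rw [coverSide, div_div]
  have hamgm : (∏ i, ((k i : ℝ) + 1) / K) ^ ((1 : ℝ) / d) ≤ (1 + d / K) / d := by
    rw [← Real.finsetProd_rpow _ _ hnum]
    refine (Real.geom_mean_le_arith_mean_weighted Finset.univ (fun _ => (1 : ℝ) / d) _
      (fun _ _ => by positivity) ?_ hnum).trans ?_
    · rw [Finset.sum_const, Finset.card_univ, Fintype.card_fin, nsmul_eq_mul]
      field_simp
    · rw [← Finset.mul_sum, ← Finset.sum_div, Finset.sum_add_distrib, Finset.sum_const,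
        Finset.card_univ, Fintype.card_fin, nsmul_eq_mul, mul_one]
      have : (∑ i, (k i : ℝ) + d) / K ≤ (K + d) / K := by gcongr
      calc _ ≤ 1 / (d : ℝ) * ((K + d) / K) := by gcongr
        _ = _ := by field_simp
  rw [hsplit, Real.div_rpow (Finset.prod_nonneg hnum) hV.le]
  have hVr : 0 < (∏ i, v i) ^ ((1 : ℝ) / d) := Real.rpow_pos_of_pos hV _
  calc _ ≤ (1 + d / K) / d / (∏ i, v i) ^ ((1 : ℝ) / d) := by gcongr
    _ = _ := by field_simp

lemma prod_one_div_mul_rpow (hd : 0 < d) (hv : ∀ i, 0 < v i) :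
    (∏ i, 1 / (d * v i)) ^ ((1 : ℝ) / d) = 1 / (d * (∏ i, v i) ^ ((1 : ℝ) / d)) := by
  have hd' : (0 : ℝ) < d := by exact_mod_cast hd
  have hV : 0 < ∏ i, v i := Finset.prod_pos fun i _ => hv i
  rw [Finset.prod_div_distrib, Finset.prod_const_one, Finset.prod_mul_distrib, Finset.prod_const,
    Finset.card_univ, Fintype.card_fin, Real.div_rpow zero_le_one (by positivity),
    Real.one_rpow, Real.mul_rpow (by positivity) hV.le, one_div (d : ℝ),
    Real.pow_rpow_inv_natCast hd'.le hd.ne']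

end Simplex

lemma tsum_lt_top_of_eventually_le_exp {f : ℕ → ENNReal} (hf : ∀ n, f n ≤ 1) {g : ℕ → ℝ}
    (hg : Summable fun n => Real.exp (g n))
    (h : ∀ᶠ n in atTop, f n ≤ ENNReal.ofReal (Real.exp (g n))) : ∑' n, f n < ⊤ := by
  obtain ⟨m, hm⟩ := eventually_atTop.1 h
  rw [← ENNReal.summable.sum_add_tsum_nat_add' (k := m)]
  refine ENNReal.add_lt_top.2 ⟨ENNReal.sum_lt_top.2 fun n _ => (hf n).trans_lt ENNReal.one_lt_top,
    ?_⟩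
  refine (ENNReal.tsum_le_tsum fun n => hm (n + m) (by omega)).trans_lt ?_
  rw [← ENNReal.ofReal_tsum_of_nonneg (fun n => (Real.exp_pos _).le)
    ((summable_nat_add_iff m).2 hg)]
  exact ENNReal.ofReal_lt_top

lemma tendsto_atTop_of_summable_exp {d : ℕ} (hd : 0 < d) {t : ℕ → ℝ} (htpos : ∀ n, 0 < t n)
    (h : Summable fun n : ℕ => Real.exp (-1 * t n ^ ((1 : ℝ) / d))) : Tendsto t atTop atTop := by
  have h1 : Tendsto (fun n => t n ^ ((1 : ℝ) / d)) atTop atTop := by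
    have := Real.tendsto_exp_comp_nhds_zero.1 h.tendsto_atTop_zero
    simpa [Function.comp_def] using tendsto_neg_atBot_atTop.comp this
  refine ((tendsto_pow_atTop hd.ne').comp h1).congr fun n => ?_
  simp only [Function.comp, one_div]
  exact Real.rpow_inv_natCast_pow (htpos n).le hd.ne'

/-- Complete convergence of `t_n^{-1/d} ℓ(𝒫_{t_n} ∩ S_{x,v})` to
`c_d / (d (v_1 ⋯ v_d)^{1/d})`. -/
theorem longest_chain_simplex_complete_convergence
    {d : ℕ} (hd : 0 < d) (c : ℝ) (hc : IsBWConstant d c)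
    (x v : Fin d → ℝ) (hx : ∀ i, 0 < x i) (hv : ∀ i, 0 < v i)
    {Ω : Type*} [MeasurableSpace Ω] (P : Measure Ω) [IsProbabilityMeasure P]
    (PP : ∀ t : ℝ, 0 < t → PoissonPP d P fun _ => t)
    (t : ℕ → ℝ) (htpos : ∀ n, 0 < t n) (htmono : StrictMono t)
    (htsum : ∀ ε : ℝ, 0 < ε →
      Summable fun n : ℕ => Real.exp (-ε * t n ^ ((1 : ℝ) / d))) :
    ∀ ε : ℝ, 0 < ε →
      (∑' n : ℕ, P {ω |
        ε < |t n ^ (-(1 : ℝ) / d) *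
          (chainLength d ((PP (t n) (htpos n)).pts ω ∩ simplexS d x v) : ℝ) -
            c / (d * (∏ i, v i) ^ ((1 : ℝ) / d))|}) < ⊤ := by
  classical
  intro ε hε
  have ht : Tendsto t atTop atTop := tendsto_atTop_of_summable_exp hd htpos (htsum 1 one_pos)
  have hd' : (0 : ℝ) < d := by exact_mod_cast hd
  have hV : 0 < ∏ i, v i := Finset.prod_pos fun i _ => hv i
  have hVr : 0 < (∏ i, v i) ^ ((1 : ℝ) / d) := Real.rpow_pos_of_pos hV _
  set κ := 1 / (d * (∏ i, v i) ^ ((1 : ℝ) / d)) with hκ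
  have hκ0 : 0 < κ := by positivity
  have hc0 := hc.1
  have hμ : c / (d * (∏ i, v i) ^ ((1 : ℝ) / d)) = c * κ := by
    rw [hκ]
    ring
  rw [hμ]
  have hμ0 : 0 < c * κ := by positivity
  obtain ⟨K, hK⟩ := exists_nat_gt (max 0 (2 * (c * κ) * d / ε))
  have hK0 : (0 : ℝ) < K := (le_max_left _ _).trans_lt hK
  have hKpos : 0 < K := by exact_mod_cast hK0
  have hK2 : c * κ * (d / K) ≤ ε / 2 := by
    have h1 := ((le_max_right _ _).trans_lt hK).le
    rw [div_le_iff₀ hε] at h1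
    rw [mul_div_assoc', div_le_iff₀ hK0]
    linarith
  -- the lower tail
  set ε' := min ε (c * κ / 2) with hε'
  have hε'0 : 0 < ε' := lt_min hε (by positivity)
  have hε'c : ε' < c * κ := (min_le_right _ _).trans_lt (by linarith)
  set w : Fin d → ℝ := fun i => 1 / (d * v i) with hw
  have hw0 : ∀ i, 0 < w i := fun i => by
    have := hv i
    positivity
  have hwW : (∏ i, w i) ^ ((1 : ℝ) / d) = κ := prod_one_div_mul_rpow hd hv
  obtain ⟨δ, hδ, hlow⟩ := eventually_measure_chainLength_boxBelow_le hd hc P x hw0 hε'0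
    (by rwa [hwW])
  rw [hwW] at hlow
  set lower : ℕ → ENNReal := fun n => P {ω |
    (chainLength d ((PP (t n) (htpos n)).pts ω ∩ boxBelow x w) : ℝ)
      ≤ (c * κ - ε') * t n ^ ((1 : ℝ) / d)} with hlower
  have hlowsum : ∑' n, lower n < ⊤ :=
    tsum_lt_top_of_eventually_le_exp (fun n => prob_le_one) (htsum δ hδ)
      ((ht.eventually hlow).mono fun n hn => hn _)
  -- the upper tail
  set ks : Finset (Fin d → Fin (K + 1)) := Finset.univ.filter fun k => ∑ i, (k i : ℝ) ≤ K with hks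
  set upper : (Fin d → Fin (K + 1)) → ℕ → ENNReal := fun k n => P {ω |
    (c * (∏ i, coverSide v K k i) ^ ((1 : ℝ) / d) + ε / 2) * t n ^ ((1 : ℝ) / d) ≤
      chainLength d ((PP (t n) (htpos n)).pts ω ∩ boxBelow x (coverSide v K k))} with hupper
  have hupsum : ∀ k, ∑' n, upper k n < ⊤ := fun k => by
    obtain ⟨δ, hδ, hup⟩ := eventually_measure_le_chainLength_boxBelow hd hc P x
      (coverSide_pos hv hKpos k) (half_pos hε)
    exact tsum_lt_top_of_eventually_le_exp (fun n => prob_le_one) (htsum δ hδ)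
      ((ht.eventually hup).mono fun n hn => hn _)
  refine (ENNReal.tsum_le_tsum fun n => (?_ : _ ≤ lower n + ∑ k ∈ ks, upper k n)).trans_lt ?_
  · have hT : 0 < t n ^ ((1 : ℝ) / d) := Real.rpow_pos_of_pos (htpos n) _
    have hTinv : t n ^ (-(1 : ℝ) / d) = (t n ^ ((1 : ℝ) / d))⁻¹ := by
      rw [neg_div, Real.rpow_neg (htpos n).le]
    set pp := PP (t n) (htpos n) with hpp
    have hfin : ∀ u, ∀ᵐ ω ∂P, (pp.pts ω ∩ boxBelow x u).Finite := fun u =>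
      pp.ae_finite_inter (htpos n) (measurableSet_boxBelow x u) (isBounded_boxBelow x u)
    refine le_trans (measure_mono_ae (t := {ω | (chainLength d (pp.pts ω ∩ boxBelow x w) : ℝ)
      ≤ (c * κ - ε') * t n ^ ((1 : ℝ) / d)} ∪ ⋃ k ∈ ks, {ω |
      (c * (∏ i, coverSide v K k i) ^ ((1 : ℝ) / d) + ε / 2) * t n ^ ((1 : ℝ) / d) ≤
      chainLength d (pp.pts ω ∩ boxBelow x (coverSide v K k))}) ?_)
      ((measure_union_le _ _).trans (add_le_add_right (measure_biUnion_finset_le _ _) _))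
    filter_upwards [hfin fun i => 2 / v i, ae_all_iff.2 fun k => hfin (coverSide v K k)]
      with ω hfin2 hfink hω
    change ε < _ at hω
    rw [hTinv, inv_mul_eq_div, lt_abs] at hω
    rcases hω with hω | hω
    · right
      obtain ⟨k, hk, hle⟩ := exists_chainLength_simplexS_le hv hKpos hfink
      refine mem_biUnion (x := k) (Finset.mem_filter.2 ⟨Finset.mem_univ _, hk⟩) ?_
      have h1 : c * κ + ε < chainLength d (pp.pts ω ∩ simplexS d x v) / t n ^ ((1 : ℝ) / d) := by
        linarith
      rw [lt_div_iff₀ hT] at h1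
      have h2 := mul_le_mul_of_nonneg_left (prod_rpow_one_div_le hd hKpos hv hk) hc0.le
      have h3 : (chainLength d (pp.pts ω ∩ simplexS d x v) : ℝ)
          ≤ chainLength d (pp.pts ω ∩ boxBelow x (coverSide v K k)) := by exact_mod_cast hle
      refine le_trans (mul_le_mul_of_nonneg_right ?_ hT.le) (h1.le.trans h3)
      rw [← hκ] at h2
      linarith
    · left
      have h1 : chainLength d (pp.pts ω ∩ simplexS d x v) / t n ^ ((1 : ℝ) / d) < c * κ - ε' := by
        linarith [min_le_left ε (c * κ / 2)]
      rw [div_lt_iff₀ hT] at h1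
      refine le_trans ?_ h1.le
      exact_mod_cast chainLength_mono
        (hfin2.subset (inter_subset_inter_right _ (simplexS_subset_boxBelow hv)))
        (inter_subset_inter_right _ (boxBelow_subset_simplexS hd hv))
  · rw [ENNReal.tsum_add, Summable.tsum_finsetSum fun _ _ => ENNReal.summable]
    exact ENNReal.add_lt_top.2 ⟨hlowsum, ENNReal.sum_lt_top.2 fun k _ => hupsum k⟩

end
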